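/- arXiv:2308.03156 — 4 statements merged into one kernel-verified Lean document; each statement's English description precedes it below -/
import Mathlib

section
/- There exist ν₀ ∈ (0,1) and a constant C > 0, depending only on γ, ρ₊, u₊, θ₊ and independent of ν, such that for every ν ∈ (0, ν₀]: sup_{ξ ∈ ℝ} |ρ_ν^r(ξ) − ρ^r(ξ)| ≤ Cν, sup_{ξ ∈ ℝ} |m_ν^r(ξ) − m^r(ξ)| ≤ Cν, and sup_{ξ ∈ ℝ} |n_ν^r(ξ) − n^r(ξ)| ≤ Cν. (Equivalently, for every t > 0 the functions of x₁, (ρ_ν^r, m_ν^r, n_ν^r)(x₁/t) and (ρ^r, m^r, n^r)(x₁/t), differ by at most Cν in the sup norm.) -/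
/-- The sound speed `c(θ) = √(γ(γ−1)θ)` (ideal polytropic gas, `R = γ − 1`). -/
noncomputable def sndSpeed (γ θ : ℝ) : ℝ := Real.sqrt (γ * (γ - 1) * θ)

/-- The vacuum boundary speed `u₋ = u₊ − 2c(θ₊)/(γ−1)`. -/
noncomputable def uMinus (γ up θp : ℝ) : ℝ := up - 2 * sndSpeed γ θp / (γ - 1)

/-- Temperature of the centered 3-rarefaction wave connecting the vacuum to
`(ρ₊, u₊, θ₊)`, as a function of the self-similar variable `ξ = x₁/t`. -/
noncomputable def thetaR (γ up θp : ℝ) (ξ : ℝ) : ℝ :=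
  if ξ ≤ uMinus γ up θp then 0
  else if ξ ≤ up + sndSpeed γ θp then
    (γ - 1) * (ξ - uMinus γ up θp) ^ 2 / (γ * (γ + 1) ^ 2)
  else θp

/-- Density of the centered 3-rarefaction wave. -/
noncomputable def rhoR (γ ρp up θp : ℝ) (ξ : ℝ) : ℝ :=
  ρp * (thetaR γ up θp ξ / θp) ^ (1 / (γ - 1))

/-- Velocity of the centered 3-rarefaction wave. -/
noncomputable def uR (γ up θp : ℝ) (ξ : ℝ) : ℝ :=
  if ξ ≤ up + sndSpeed γ θp then
    uMinus γ up θp + (2 / (γ - 1)) * sndSpeed γ (thetaR γ up θp ξ)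
  else up

/-- Momentum `m^r = ρ^r u^r` of the centered 3-rarefaction wave
(equal to `0` where `ρ^r = 0`). -/
noncomputable def mR (γ ρp up θp : ℝ) (ξ : ℝ) : ℝ :=
  rhoR γ ρp up θp ξ * uR γ up θp ξ

/-- Total internal energy `n^r = ρ^r θ^r` of the centered 3-rarefaction wave
(equal to `0` where `ρ^r = 0`). -/
noncomputable def nR (γ ρp up θp : ℝ) (ξ : ℝ) : ℝ :=
  rhoR γ ρp up θp ξ * thetaR γ up θp ξ

/-- The temperature `θ_ν = θ₊ (ν/ρ₊)^{γ−1}` of the cut-off state. -/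
noncomputable def thetaNu (γ ρp θp ν : ℝ) : ℝ := θp * (ν / ρp) ^ (γ - 1)

/-- The velocity `u_ν = u₋ + 2c(θ_ν)/(γ−1)` of the cut-off state. -/
noncomputable def uNu (γ ρp up θp ν : ℝ) : ℝ :=
  uMinus γ up θp + 2 * sndSpeed γ (thetaNu γ ρp θp ν) / (γ - 1)

/-- The speed `λ_ν = u_ν + c(θ_ν)`. -/
noncomputable def lamNu (γ ρp up θp ν : ℝ) : ℝ :=
  uNu γ ρp up θp ν + sndSpeed γ (thetaNu γ ρp θp ν)

/-- Density of the cut-off 3-rarefaction wave connecting `(ν, u_ν, θ_ν)` to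
`(ρ₊, u₊, θ₊)`. -/
noncomputable def rhoNuR (γ ρp up θp ν : ℝ) (ξ : ℝ) : ℝ :=
  if ξ ≤ lamNu γ ρp up θp ν then ν else rhoR γ ρp up θp ξ

/-- Velocity of the cut-off 3-rarefaction wave. -/
noncomputable def uNuR (γ ρp up θp ν : ℝ) (ξ : ℝ) : ℝ :=
  if ξ ≤ lamNu γ ρp up θp ν then uNu γ ρp up θp ν else uR γ up θp ξ

/-- Temperature of the cut-off 3-rarefaction wave. -/
noncomputable def thetaNuR (γ ρp up θp ν : ℝ) (ξ : ℝ) : ℝ :=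
  if ξ ≤ lamNu γ ρp up θp ν then thetaNu γ ρp θp ν else thetaR γ up θp ξ

/-- Momentum of the cut-off 3-rarefaction wave. -/
noncomputable def mNuR (γ ρp up θp ν : ℝ) (ξ : ℝ) : ℝ :=
  rhoNuR γ ρp up θp ν ξ * uNuR γ ρp up θp ν ξ

/-- Total internal energy of the cut-off 3-rarefaction wave. -/
noncomputable def nNuR (γ ρp up θp ν : ℝ) (ξ : ℝ) : ℝ :=
  rhoNuR γ ρp up θp ν ξ * thetaNuR γ ρp up θp ν ξ

lemma sndSpeed_nonneg (γ θ : ℝ) : 0 ≤ sndSpeed γ θ := Real.sqrt_nonneg _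

lemma sndSpeed_mono {γ θ θ' : ℝ} (hγ : 1 < γ) (h : θ ≤ θ') : sndSpeed γ θ ≤ sndSpeed γ θ' :=
  Real.sqrt_le_sqrt (mul_le_mul_of_nonneg_left h (by nlinarith))

lemma sndSpeed_sq {γ θ : ℝ} (hγ : 1 < γ) (h : 0 ≤ θ) : sndSpeed γ θ ^ 2 = γ * (γ - 1) * θ :=
  Real.sq_sqrt (mul_nonneg (by nlinarith) h)

lemma thetaNu_nonneg {γ ρp θp ν : ℝ} (hρp : 0 < ρp) (hθp : 0 < θp) (hν : 0 ≤ ν) :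
    0 ≤ thetaNu γ ρp θp ν := by
  unfold thetaNu
  positivity

lemma thetaNu_le {γ ρp θp ν : ℝ} (hγ : 1 < γ) (hρp : 0 < ρp) (hθp : 0 < θp) (hν : 0 ≤ ν)
    (hνρ : ν ≤ ρp) : thetaNu γ ρp θp ν ≤ θp :=
  mul_le_of_le_one_right hθp.le
    (Real.rpow_le_one (by positivity) ((div_le_one hρp).2 hνρ) (by linarith))

lemma lamNu_eq {γ : ℝ} (hγ : 1 < γ) (ρp up θp ν : ℝ) :
    lamNu γ ρp up θp ν =
      uMinus γ up θp + (γ + 1) / (γ - 1) * sndSpeed γ (thetaNu γ ρp θp ν) := by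
  have : γ - 1 ≠ 0 := by linarith
  unfold lamNu uNu
  field_simp
  ring

lemma lamNu_le {γ ρp up θp ν : ℝ} (hγ : 1 < γ) (hρp : 0 < ρp) (hθp : 0 < θp) (hν : 0 ≤ ν)
    (hνρ : ν ≤ ρp) : lamNu γ ρp up θp ν ≤ up + sndSpeed γ θp := by
  have h1 : 0 < γ - 1 := by linarith
  have h := mul_le_mul_of_nonneg_left (sndSpeed_mono hγ (thetaNu_le hγ hρp hθp hν hνρ))
    (by positivity : 0 ≤ 2 / (γ - 1))
  have h' := sndSpeed_mono hγ (thetaNu_le hγ hρp hθp hν hνρ)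
  unfold lamNu uNu uMinus
  rw [mul_div_right_comm, mul_div_right_comm]
  linarith

lemma thetaR_nonneg {γ θp : ℝ} (hγ : 1 < γ) (hθp : 0 < θp) (up ξ : ℝ) :
    0 ≤ thetaR γ up θp ξ := by
  have h1 : 0 < γ - 1 := by linarith
  unfold thetaR
  split_ifs <;> positivity

lemma thetaR_le_thetaNu {γ ρp up θp ν ξ : ℝ} (hγ : 1 < γ) (hρp : 0 < ρp) (hθp : 0 < θp)
    (hν : 0 ≤ ν) (hνρ : ν ≤ ρp) (hξ : ξ ≤ lamNu γ ρp up θp ν) :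
    thetaR γ up θp ξ ≤ thetaNu γ ρp θp ν := by
  have h1 : 0 < γ - 1 := by linarith
  have hθν := thetaNu_nonneg (γ := γ) hρp hθp hν
  unfold thetaR
  split_ifs with h h'
  · exact hθν
  · have hle : ξ - uMinus γ up θp ≤ (γ + 1) / (γ - 1) * sndSpeed γ (thetaNu γ ρp θp ν) := by
      rw [lamNu_eq hγ] at hξ
      linarith
    have hsq := pow_le_pow_left₀ (by linarith) hle 2
    rw [mul_pow, sndSpeed_sq hγ hθν] at hsq
    rw [div_le_iff₀ (by positivity)]
    calc (γ - 1) * (ξ - uMinus γ up θp) ^ 2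
        ≤ (γ - 1) * (((γ + 1) / (γ - 1)) ^ 2 * (γ * (γ - 1) * thetaNu γ ρp θp ν)) := by gcongr
      _ = thetaNu γ ρp θp ν * (γ * (γ + 1) ^ 2) := by field_simp
  · exact absurd (hξ.trans (lamNu_le hγ hρp hθp hν hνρ)) h'

lemma rhoR_nonneg {γ ρp θp : ℝ} (hγ : 1 < γ) (hρp : 0 < ρp) (hθp : 0 < θp) (up ξ : ℝ) :
    0 ≤ rhoR γ ρp up θp ξ :=
  mul_nonneg hρp.le (Real.rpow_nonneg (div_nonneg (thetaR_nonneg hγ hθp up ξ) hθp.le) _)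

lemma rhoR_le {γ ρp up θp ν ξ : ℝ} (hγ : 1 < γ) (hρp : 0 < ρp) (hθp : 0 < θp)
    (hν : 0 ≤ ν) (hνρ : ν ≤ ρp) (hξ : ξ ≤ lamNu γ ρp up θp ν) :
    rhoR γ ρp up θp ξ ≤ ν := by
  have h1 : 0 < γ - 1 := by linarith
  have hle : thetaR γ up θp ξ / θp ≤ (ν / ρp) ^ (γ - 1) := by
    rw [div_le_iff₀' hθp]
    exact thetaR_le_thetaNu hγ hρp hθp hν hνρ hξ
  have h0 : 0 ≤ thetaR γ up θp ξ / θp := div_nonneg (thetaR_nonneg hγ hθp up ξ) hθp.le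
  calc rhoR γ ρp up θp ξ ≤ ρp * ((ν / ρp) ^ (γ - 1)) ^ (1 / (γ - 1)) := by
        unfold rhoR
        gcongr
    _ = ν := by
        rw [one_div, Real.rpow_rpow_inv (by positivity) h1.ne', mul_div_cancel₀ _ hρp.ne']

lemma abs_uMinus_add_le {γ up θp θ : ℝ} (hγ : 1 < γ) (h : θ ≤ θp) :
    |uMinus γ up θp + 2 / (γ - 1) * sndSpeed γ θ| ≤
      |uMinus γ up θp| + 2 / (γ - 1) * sndSpeed γ θp := by
  have h1 : 0 < γ - 1 := by linarith
  have h0 := sndSpeed_nonneg γ θ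
  refine (abs_add_le _ _).trans ?_
  rw [abs_of_nonneg (by positivity : 0 ≤ 2 / (γ - 1) * sndSpeed γ θ)]
  gcongr
  exact sndSpeed_mono hγ h


/-- The cut-off 3-rarefaction wave converges to the original
3-rarefaction wave in the sup norm with rate `ν` as `ν → 0`, uniformly in the
self-similar variable (equivalently, uniformly in `x₁` for every `t > 0`). -/
theorem cutoff_rarefaction_sup_convergence
    (γ ρp up θp : ℝ) (hγ : 1 < γ) (hρp : 0 < ρp) (hθp : 0 < θp) :
    ∃ ν₀ ∈ Set.Ioo (0 : ℝ) 1, ∃ C : ℝ, 0 < C ∧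
      ∀ ν ∈ Set.Ioc (0 : ℝ) ν₀,
        (∀ ξ : ℝ, |rhoNuR γ ρp up θp ν ξ - rhoR γ ρp up θp ξ| ≤ C * ν) ∧
        (∀ ξ : ℝ, |mNuR γ ρp up θp ν ξ - mR γ ρp up θp ξ| ≤ C * ν) ∧
        (∀ ξ : ℝ, |nNuR γ ρp up θp ν ξ - nR γ ρp up θp ξ| ≤ C * ν) := by
  have h1 : 0 < γ - 1 := by linarith
  have hc := sndSpeed_nonneg γ θp
  set U : ℝ := |uMinus γ up θp| + 2 / (γ - 1) * sndSpeed γ θp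
  have hU0 : 0 ≤ U := by positivity
  refine ⟨min ρp 1 / 2, ⟨by positivity, by linarith [min_le_right ρp 1]⟩, 1 + 2 * U + θp,
    by positivity, fun ν hν => ?_⟩
  have hν0 : 0 ≤ ν := hν.1.le
  have hνρ : ν ≤ ρp := by linarith [hν.2, min_le_left ρp 1]
  have hθν := thetaNu_le hγ hρp hθp hν0 hνρ
  have hθν0 := thetaNu_nonneg (γ := γ) hρp hθp hν0
  have hUν : 0 ≤ U * ν := mul_nonneg hU0 hν0
  have hθpν : 0 ≤ θp * ν := mul_nonneg hθp.le hν0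
  have hCν : 0 ≤ (1 + 2 * U + θp) * ν := by positivity
  refine ⟨fun ξ => ?_, fun ξ => ?_, fun ξ => ?_⟩ <;>
    rcases lt_or_ge (lamNu γ ρp up θp ν) ξ with hξ | hξ
  · simpa [rhoNuR, hξ.not_ge] using hCν
  · have hρ := rhoR_le hγ hρp hθp hν0 hνρ hξ
    have hρ0 := rhoR_nonneg hγ hρp hθp up ξ
    rw [rhoNuR, if_pos hξ, abs_le]
    constructor <;> linarith
  · simpa [mNuR, mR, rhoNuR, uNuR, hξ.not_ge] using hCν
  · have hρ := rhoR_le hγ hρp hθp hν0 hνρ hξ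
    have hρ0 := rhoR_nonneg hγ hρp hθp up ξ
    have hu : |uR γ up θp ξ| ≤ U := by
      rw [uR, if_pos (hξ.trans (lamNu_le hγ hρp hθp hν0 hνρ))]
      exact abs_uMinus_add_le hγ ((thetaR_le_thetaNu hγ hρp hθp hν0 hνρ hξ).trans hθν)
    have huν : |uNu γ ρp up θp ν| ≤ U := by
      rw [uNu, mul_div_right_comm]
      exact abs_uMinus_add_le hγ hθν
    rw [mNuR, mR, rhoNuR, uNuR, if_pos hξ, if_pos hξ]
    calc |ν * uNu γ ρp up θp ν - rhoR γ ρp up θp ξ * uR γ up θp ξ|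
        ≤ ν * |uNu γ ρp up θp ν| + rhoR γ ρp up θp ξ * |uR γ up θp ξ| := by
          refine (abs_sub _ _).trans_eq ?_
          rw [abs_mul, abs_mul, abs_of_nonneg hν0, abs_of_nonneg hρ0]
      _ ≤ ν * U + ν * U := by gcongr
      _ ≤ (1 + 2 * U + θp) * ν := by linarith
  · simpa [nNuR, nR, rhoNuR, thetaNuR, hξ.not_ge] using hCν
  · have hρ := rhoR_le hγ hρp hθp hν0 hνρ hξ
    have hρ0 := rhoR_nonneg hγ hρp hθp up ξ
    have hθ0 := thetaR_nonneg hγ hθp up ξ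
    have hθ := (thetaR_le_thetaNu hγ hρp hθp hν0 hνρ hξ).trans hθν
    have hn := mul_le_mul hρ hθ hθ0 hν0
    have hn0 := mul_nonneg hρ0 hθ0
    have hnν := mul_le_mul_of_nonneg_left hθν hν0
    have hnν0 := mul_nonneg hν0 hθν0
    rw [nNuR, nR, rhoNuR, thetaNuR, if_pos hξ, if_pos hξ, abs_le]
    constructor <;> linarith
end

section
/- There exists a constant C > 0, depending only on w₋ and w₊ (and not on δ, t or p), such that for every t ≥ 0 and every p ∈ [1,∞]: ‖∂_x w(t,·)‖_{L^p(ℝ)} ≤ C (δ + t)^{−1 + 1/p} and ‖∂_x² w(t,·)‖_{L^p(ℝ)} ≤ C (δ + t)^{−1} δ^{−1 + 1/p}. -/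
open MeasureTheory
open scoped ENNReal

open Set Filter Topology

/-- `w` is continuously differentiable in space and solves the Burgers equation pointwise at all
times in `I`. No joint regularity in space and time is assumed. -/
def IsBurgersOn (w : ℝ → ℝ → ℝ) (I : Set ℝ) : Prop :=
  (∀ t ∈ I, ContDiff ℝ 1 (w t)) ∧
    ∀ t ∈ I, ∀ x, HasDerivAt (fun s => w s x) (-(w t x * deriv (w t) x)) t

namespace IsBurgersOn

variable {w : ℝ → ℝ → ℝ} {I J : Set ℝ}

lemma mono (h : IsBurgersOn w I) (hJ : J ⊆ I) : IsBurgersOn w J :=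
  ⟨fun t ht => h.1 t (hJ ht), fun t ht => h.2 t (hJ ht)⟩

lemma hasDerivAt_space (h : IsBurgersOn w I) {t : ℝ} (ht : t ∈ I) (x : ℝ) :
    HasDerivAt (w t) (deriv (w t) x) x :=
  ((h.1 t ht).differentiable one_ne_zero x).hasDerivAt

lemma continuousOn_time (h : IsBurgersOn w I) (x : ℝ) : ContinuousOn (fun t => w t x) I :=
  fun t ht => (h.2 t ht x).continuousAt.continuousWithinAt

/-- The Burgers equation is invariant under time reversal combined with a change of sign. -/
lemma reverse {a b : ℝ} (h : IsBurgersOn w (Icc a b)) :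
    IsBurgersOn (fun t x => -w (a + b - t) x) (Icc a b) := by
  have key : ∀ t ∈ Icc a b, a + b - t ∈ Icc a b := fun t ht =>
    ⟨by linarith [ht.2], by linarith [ht.1]⟩
  refine ⟨fun t ht => (h.1 _ (key t ht)).neg, fun t ht x => ?_⟩
  have h1 := h.2 _ (key t ht) x
  have h2 : HasDerivAt (fun s : ℝ => a + b - s) (-1) t := by
    simpa using (hasDerivAt_id t).const_sub (a + b)
  have h3 := (h1.comp t h2).neg
  have h4 : deriv (fun y => -w (a + b - t) y) x = -deriv (w (a + b - t)) x :=
    ((h.hasDerivAt_space (key t ht) x).neg).deriv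
  rw [h4]
  refine h3.congr_deriv ?_
  ring

end IsBurgersOn

lemma continuousOn_reverse {w : ℝ → ℝ → ℝ} {c d c' d' e : ℝ} {S : Set ℝ}
    (h : ContinuousOn (Function.uncurry w) (Icc c' d' ×ˢ S)) (hd : e - d = c') (hc : e - c = d') :
    ContinuousOn (Function.uncurry fun t x => -w (e - t) x) (Icc c d ×ˢ S) := by
  have h1 : ContinuousOn (fun p : ℝ × ℝ => ((e - p.1, p.2) : ℝ × ℝ)) (Icc c d ×ˢ S) := by
    fun_prop
  refine (h.comp h1 ?_).neg
  rintro ⟨t, x⟩ ⟨ht, hx⟩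
  exact ⟨⟨by simp only; linarith [ht.2], by simp only; linarith [ht.1]⟩, hx⟩

lemma HasDerivAt.nonneg_of_isMaxOn_Icc {f : ℝ → ℝ} {f' a b : ℝ} (hf : HasDerivAt f f' b)
    (hab : a < b) (hmax : ∀ t ∈ Icc a b, f t ≤ f b) : 0 ≤ f' := by
  have h1 : Tendsto (slope f b) (𝓝[<] b) (𝓝 f') :=
    (hasDerivWithinAt_iff_tendsto_slope' (by simp)).1 (hf.hasDerivWithinAt (s := Iio b))
  refine ge_of_tendsto h1 ?_
  filter_upwards [Ioo_mem_nhdsLT hab] with t ht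
  rw [slope_def_field]
  exact div_nonneg_of_nonpos (by linarith [hmax t ⟨ht.1.le, ht.2.le⟩]) (by linarith [ht.2])

/-- A maximum principle on a rectangle for functions that are merely differentiable in each
variable separately. -/
lemma nonpos_of_parabolic_boundary {f : ℝ → ℝ → ℝ} {a b l r : ℝ}
    (hf : ContinuousOn (Function.uncurry f) (Icc a b ×ˢ Icc l r))
    (ha : ∀ x ∈ Icc l r, f a x ≤ 0)
    (hl : ∀ t ∈ Icc a b, f t l ≤ 0) (hr : ∀ t ∈ Icc a b, f t r ≤ 0)
    (hd : ∀ t ∈ Ioc a b, ∀ x ∈ Ioo l r, 0 < f t x → ∃ ft fx,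
      HasDerivAt (fun s => f s x) ft t ∧ HasDerivAt (f t) fx x ∧ (fx = 0 → ft < 0)) :
    ∀ t ∈ Icc a b, ∀ x ∈ Icc l r, f t x ≤ 0 := by
  intro t₀ ht₀ x₀ hx₀
  obtain ⟨⟨t, x⟩, ⟨ht, hx⟩, hmax⟩ :=
    (isCompact_Icc.prod isCompact_Icc).exists_isMaxOn ⟨(t₀, x₀), ht₀, hx₀⟩ hf
  by_contra! hpos
  have hmax' : ∀ s ∈ Icc a b, ∀ y ∈ Icc l r, f s y ≤ f t x := fun s hs y hy =>
    hmax (show (s, y) ∈ Icc a b ×ˢ Icc l r from ⟨hs, hy⟩)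
  simp only at ht hx
  have hp : 0 < f t x := hpos.trans_le (hmax' _ ht₀ _ hx₀)
  have hta : a < t := lt_of_le_of_ne ht.1 (by rintro rfl; linarith [ha x hx])
  have hxl : l < x := lt_of_le_of_ne hx.1 (by rintro rfl; linarith [hl t ht])
  have hxr : x < r := lt_of_le_of_ne hx.2 (by rintro rfl; linarith [hr t ht])
  obtain ⟨ft, fx, h1, h2, h3⟩ := hd t ⟨hta, ht.2⟩ x ⟨hxl, hxr⟩ hp
  have hloc : IsLocalMax (f t) x := by
    filter_upwards [Ioo_mem_nhds hxl hxr] with y hy using hmax' t ht y ⟨hy.1.le, hy.2.le⟩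
  have := h1.nonneg_of_isMaxOn_Icc hta
    fun s hs => hmax' s ⟨hs.1, hs.2.trans ht.2⟩ x hx
  linarith [h3 (hloc.hasDerivAt_eq_zero h2)]

namespace IsBurgersOn

variable {w : ℝ → ℝ → ℝ} {a b l r : ℝ}

/-- A bound in terms of the lateral boundary values, gaining from the elapsed time. -/
lemma bound_aux (h : IsBurgersOn w (Icc a b))
    (hc : ContinuousOn (Function.uncurry w) (Icc a b ×ˢ Icc l r))
    {σ τ N e : ℝ} (hlr : l ≤ r) (hσ : σ = 1 ∨ σ = -1) (hτ : 0 ≤ τ) (hN : 0 < N)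
    (he : ∀ x ∈ Icc l r, e ≤ σ * x)
    (ha : ∀ x ∈ Icc l r, τ * (σ * w a x - N) ≤ σ * x - e)
    (hl : ∀ t ∈ Icc a b, |w t l| ≤ N) (hr : ∀ t ∈ Icc a b, |w t r| ≤ N) :
    ∀ t ∈ Icc a b, ∀ x ∈ Icc l r, (τ + (t - a)) * (σ * w t x - N) ≤ σ * x - e := by
  have hside : ∀ t ∈ Icc a b, ∀ x ∈ Icc l r, |w t x| ≤ N →
      (τ + (t - a)) * (σ * w t x - N) - (σ * x - e) ≤ 0 := by
    intro t ht x hx hN'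
    have h1 : σ * w t x ≤ N := by
      rcases hσ with rfl | rfl <;> linarith [abs_le.1 hN']
    have := mul_nonneg (show 0 ≤ τ + (t - a) by linarith [ht.1]) (sub_nonneg.2 h1)
    linarith [he x hx]
  have key := nonpos_of_parabolic_boundary
    (f := fun t x => (τ + (t - a)) * (σ * w t x - N) - (σ * x - e)) (a := a) (b := b)
    (l := l) (r := r) ?_ ?_ ?_ ?_ ?_
  · intro t ht x hx
    linarith [key t ht x hx]
  · simp only [Function.uncurry_def]
    simp only [Function.uncurry_def] at hc
    fun_prop
  · intro x hx
    simpa using ha x hx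
  · exact fun t ht => hside t ht l ⟨le_rfl, hlr⟩ (hl t ht)
  · exact fun t ht => hside t ht r ⟨hlr, le_rfl⟩ (hr t ht)
  · intro t ht x hx _
    have htI : t ∈ Icc a b := ⟨ht.1.le, ht.2⟩
    have h1 : HasDerivAt (fun s => τ + (s - a)) 1 t := by
      simpa using ((hasDerivAt_id t).sub_const a).const_add τ
    refine ⟨_, _, ((h1.mul (((h.2 t htI x).const_mul σ).sub_const N)).sub_const _),
      ((((h.hasDerivAt_space htI x).const_mul σ).sub_const N).const_mul _).sub
        (((hasDerivAt_id x).const_mul σ).sub_const e), ?_⟩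
    intro h0
    have hs : σ * σ = 1 := by rcases hσ with rfl | rfl <;> norm_num
    have h2 : (τ + (t - a)) * deriv (w t) x = 1 := by
      linear_combination σ * h0 - ((τ + (t - a)) * deriv (w t) x - 1) * hs
    have h3 : 1 * (σ * w t x - N) + (τ + (t - a)) * (σ * -(w t x * deriv (w t) x)) = -N := by
      linear_combination (-(σ * w t x)) * h2
    linarith

/-- Short-time constancy along characteristics. -/
lemma const_local {s T x₁ ρ A : ℝ} (h : IsBurgersOn w (Icc s T)) (hsT : s ≤ T) (hρ : 0 < ρ)
    (hc : ContinuousOn (Function.uncurry w) (Icc s T ×ˢ Icc (x₁ - ρ) (x₁ + ρ)))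
    (hA : ∀ t ∈ Icc s T, ∀ x ∈ Icc (x₁ - ρ) (x₁ + ρ), |w t x| ≤ A)
    (hsmall : 2 * (A + 1) * (T - s) < ρ) :
    w s (x₁ - (T - s) * w T x₁) = w T x₁ := by
  have hsI : s ∈ Icc s T := ⟨le_rfl, hsT⟩
  have hTI : T ∈ Icc s T := ⟨hsT, le_rfl⟩
  have hx₁ : x₁ ∈ Icc (x₁ - ρ) (x₁ + ρ) := ⟨by linarith, by linarith⟩
  have hA0 : 0 ≤ A := (abs_nonneg _).trans (hA s hsI x₁ hx₁)
  set G : ℝ → ℝ → ℝ := fun t x => w s (x - (t - s) * w t x) - w t x with hG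
  have hGc : ContinuousOn (Function.uncurry G) (Icc s T ×ˢ Icc (x₁ - ρ) (x₁ + ρ)) := by
    have h1 : Continuous (w s) := (h.1 s hsI).continuous
    simp only [Function.uncurry_def, hG]
    simp only [Function.uncurry_def] at hc
    fun_prop
  obtain ⟨Γ₀, hΓ₀⟩ := (isCompact_Icc.prod isCompact_Icc).exists_bound_of_continuousOn hGc
  obtain ⟨Γ, hΓ, hΓpos⟩ : ∃ Γ, Γ₀ ≤ Γ ∧ 0 < Γ := ⟨|Γ₀| + 1, by linarith [le_abs_self Γ₀],
    by positivity⟩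
  set κ : ℝ := 2 * (A + 1) / ρ with hκ
  have hκ0 : 0 ≤ κ := by positivity
  have hq : κ * (T - s) < 1 := by
    rw [hκ, div_mul_eq_mul_div, div_lt_one hρ]; exact hsmall
  have main : ∀ σ : ℝ, (σ = 1 ∨ σ = -1) → σ * G T x₁ ≤ 0 := by
    intro σ hσ
    have hside : ∀ m : ℕ, ∀ t ∈ Icc s T, ∀ x ∈ Icc (x₁ - ρ) (x₁ + ρ), (x - x₁) ^ 2 = ρ ^ 2 →
        σ * G t x - Γ * Real.exp ((m + 1) * ((x - x₁) ^ 2 / ρ ^ 2 + κ * (t - s) - 1)) ≤ 0 := by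
      intro m t ht x hx hxρ
      have h1 : σ * G t x ≤ Γ := by
        have := abs_le.1 ((hΓ₀ (t, x) ⟨ht, hx⟩).trans hΓ)
        simp only [Function.uncurry] at this
        rcases hσ with rfl | rfl <;> linarith
      have h2 : 1 ≤ Real.exp ((m + 1) * ((x - x₁) ^ 2 / ρ ^ 2 + κ * (t - s) - 1)) := by
        rw [Real.one_le_exp_iff, hxρ, div_self (by positivity)]
        have := mul_nonneg hκ0 (sub_nonneg.2 ht.1)
        exact mul_nonneg (by positivity) (by linarith)
      nlinarith
    have step : ∀ m : ℕ, σ * G T x₁ ≤ Γ * Real.exp (κ * (T - s) - 1) ^ (m + 1) := by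
      intro m
      have key := nonpos_of_parabolic_boundary (f := fun t x => σ * G t x -
        Γ * Real.exp ((m + 1) * ((x - x₁) ^ 2 / ρ ^ 2 + κ * (t - s) - 1)))
        (a := s) (b := T) (l := x₁ - ρ) (r := x₁ + ρ) ?_ ?_ ?_ ?_ ?_ T hTI x₁ hx₁
      · have h2 : Real.exp (κ * (T - s) - 1) ^ (m + 1) =
            Real.exp ((m + 1) * ((x₁ - x₁) ^ 2 / ρ ^ 2 + κ * (T - s) - 1)) := by
          rw [← Real.exp_nat_mul]; congr 1; push_cast; ring
        rw [h2]
        linarith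
      · simp only [Function.uncurry_def]
        simp only [Function.uncurry_def] at hGc
        fun_prop
      · intro x hx
        simp only [hG, sub_self, zero_mul, sub_zero, mul_zero, zero_sub]
        have := Real.exp_pos ((m + 1) * ((x - x₁) ^ 2 / ρ ^ 2 + 0 - 1))
        nlinarith
      all_goals
        first
        | intro t ht x hx _
          have htI : t ∈ Icc s T := ⟨ht.1.le, ht.2⟩
          have hxI : x ∈ Icc (x₁ - ρ) (x₁ + ρ) := ⟨hx.1.le, hx.2.le⟩
          have hs' : HasDerivAt (fun u : ℝ => u - s) 1 t := (hasDerivAt_id t).sub_const s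
          have hwt := h.2 t htI x
          have hwx := h.hasDerivAt_space htI x
          have e1 := (((hs'.mul hwt).const_sub x))
          have e2 := (((hasDerivAt_id x).sub (hwx.const_mul (t - s))))
          have g0 := h.hasDerivAt_space hsI (x - (t - s) * w t x)
          have e3 := HasDerivAt.comp t (h₂ := w s) g0 e1
          have e4 := HasDerivAt.comp x (h₂ := w s) g0 e2
          have p1 : HasDerivAt (fun u => Γ * Real.exp ((m + 1) * ((x - x₁) ^ 2 / ρ ^ 2 +
              κ * (u - s) - 1))) _ t :=
            ((((hs'.const_mul κ).const_add ((x - x₁) ^ 2 / ρ ^ 2)).sub_const 1).const_mul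
              ((m : ℝ) + 1)).exp.const_mul Γ
          have p2 : HasDerivAt (fun y => Γ * Real.exp ((m + 1) * ((y - x₁) ^ 2 / ρ ^ 2 +
              κ * (t - s) - 1))) _ x :=
            ((((((((hasDerivAt_id x).sub_const x₁).pow 2).div_const (ρ ^ 2))).add_const
              (κ * (t - s))).sub_const 1).const_mul ((m : ℝ) + 1)).exp.const_mul Γ
          refine ⟨_, _, ((e3.sub hwt).const_mul σ).sub p1, ((e4.sub hwx).const_mul σ).sub p2, ?_⟩
          intro h0
          have hE := Real.exp_pos ((m + 1) * ((x - x₁) ^ 2 / ρ ^ 2 + κ * (t - s) - 1))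
          set E := Real.exp ((m + 1) * ((x - x₁) ^ 2 / ρ ^ 2 + κ * (t - s) - 1)) with hEdef
          have hpos : 0 < κ + w t x * (2 * (x - x₁) / ρ ^ 2) := by
            have h5 := abs_le.1 (hA t htI x hxI)
            have h6 : |x - x₁| ≤ ρ := abs_le.2 ⟨by linarith [hx.1], by linarith [hx.2]⟩
            have h7 : |w t x * (x - x₁)| ≤ A * ρ := by
              rw [abs_mul]; exact mul_le_mul (hA t htI x hxI) h6 (abs_nonneg _) hA0
            have h8 : κ + w t x * (2 * (x - x₁) / ρ ^ 2) =
                2 * ((A + 1) * ρ + w t x * (x - x₁)) / ρ ^ 2 := by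
              rw [hκ]; field_simp
            rw [h8]
            have := abs_le.1 h7
            apply div_pos _ (by positivity)
            nlinarith
          have hM : (0 : ℝ) < m + 1 := by positivity
          have hfin : 0 < Γ * E * (m + 1) * (κ + w t x * (2 * (x - x₁) / ρ ^ 2)) := by positivity
          simp only [id] at h0 ⊢
          simp at h0 ⊢
          linear_combination (-w t x) * h0 + hfin
        | intro t ht
          exact hside m t ht _ ⟨by linarith, by linarith⟩ (by ring)
    have hlim : Tendsto (fun m : ℕ => Γ * Real.exp (κ * (T - s) - 1) ^ (m + 1)) atTop
        (𝓝 (Γ * 0)) := by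
      refine ((tendsto_add_atTop_iff_nat 1).2 (tendsto_pow_atTop_nhds_zero_of_lt_one
        (Real.exp_pos _).le ?_)).const_mul Γ
      rw [Real.exp_lt_one_iff]; linarith
    rw [mul_zero] at hlim
    exact ge_of_tendsto' hlim step
  have h1 := main 1 (Or.inl rfl)
  have h2 := main (-1) (Or.inr rfl)
  simp only [hG] at h1 h2
  linarith

/-- Constancy along a backward characteristic, as long as it stays inside the rectangle. -/
lemma const_along_line (h : IsBurgersOn w (Icc a b))
    (hc : ContinuousOn (Function.uncurry w) (Icc a b ×ˢ Icc l r))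
    {s T x : ℝ} (has : a ≤ s) (hsT : s ≤ T) (hTb : T ≤ b) (hx : x ∈ Ioo l r)
    (hx' : x - (T - s) * w T x ∈ Ioo l r) : w s (x - (T - s) * w T x) = w T x := by
  set c := w T x with hcdef
  obtain ⟨A, hA⟩ := (isCompact_Icc.prod isCompact_Icc).exists_bound_of_continuousOn hc
  obtain ⟨ρ, hρ, h1, h2, h3, h4⟩ : ∃ ρ > 0, l + ρ ≤ x ∧ x + ρ ≤ r ∧
      l + ρ ≤ x - (T - s) * c ∧ x - (T - s) * c + ρ ≤ r := by
    refine ⟨min (min (x - l) (r - x)) (min (x - (T - s) * c - l) (r - (x - (T - s) * c))),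
      ?_, ?_⟩
    · simp only [gt_iff_lt, lt_inf_iff, sub_pos]
      exact ⟨⟨hx.1, hx.2⟩, hx'.1, hx'.2⟩
    · set p := min (x - l) (r - x)
      set q := min (x - (T - s) * c - l) (r - (x - (T - s) * c))
      have e1 : p ≤ x - l := min_le_left _ _
      have e2 : p ≤ r - x := min_le_right _ _
      have e3 : q ≤ x - (T - s) * c - l := min_le_left _ _
      have e4 : q ≤ r - (x - (T - s) * c) := min_le_right _ _
      have e5 := min_le_left p q
      have e6 := min_le_right p q
      refine ⟨?_, ?_, ?_, ?_⟩ <;> linarith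
  have hline : ∀ u ∈ Icc s T, l + ρ ≤ x - (T - u) * c ∧ x - (T - u) * c + ρ ≤ r := by
    intro u hu
    rcases le_total 0 c with hc0 | hc0
    · have e1 := mul_le_mul_of_nonneg_right (show T - u ≤ T - s by linarith [hu.1]) hc0
      have e2 := mul_nonneg (show 0 ≤ T - u by linarith [hu.2]) hc0
      constructor <;> linarith
    · have e1 := mul_le_mul_of_nonpos_right (show T - u ≤ T - s by linarith [hu.1]) hc0
      have e2 := mul_nonpos_of_nonneg_of_nonpos (show 0 ≤ T - u by linarith [hu.2]) hc0
      constructor <;> linarith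
  have hA0 : 0 ≤ A := (norm_nonneg _).trans
    (hA (T, x) ⟨⟨has.trans hsT, hTb⟩, hx.1.le, hx.2.le⟩)
  set η := ρ / (4 * (A + 1)) with hη
  have hη0 : 0 < η := by positivity
  have key : ∀ n : ℕ, ∀ u ∈ Icc s T, T - u ≤ n * η → w u (x - (T - u) * c) = c := by
    intro n
    induction n with
    | zero =>
      intro u hu hn
      have : u = T := le_antisymm hu.2 (by simpa using hn)
      simp [this, hcdef]
    | succ n ih =>
      intro u hu hn
      set v := min T (u + η) with hv
      have huv : u ≤ v := le_min hu.2 (by linarith)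
      have hvI : v ∈ Icc s T := ⟨hu.1.trans huv, min_le_left _ _⟩
      have hvn : T - v ≤ n * η := by
        rcases min_cases T (u + η) with ⟨e, -⟩ | ⟨e, -⟩
        · rw [hv, e, sub_self]; positivity
        · rw [hv, e]; push_cast at hn; linarith
      have hvc := ih v hvI hvn
      have hsub : Icc u v ⊆ Icc a b :=
        Icc_subset_Icc (has.trans hu.1) (hvI.2.trans hTb)
      have hsubx : Icc (x - (T - v) * c - ρ) (x - (T - v) * c + ρ) ⊆ Icc l r :=
        Icc_subset_Icc (by linarith [(hline v hvI).1]) (hline v hvI).2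
      have := const_local (h.mono hsub) huv hρ (hc.mono (prod_mono hsub hsubx))
        (fun t ht y hy => hA (t, y) ⟨hsub ht, hsubx hy⟩) (by
          have : v - u ≤ η := by linarith [min_le_right T (u + η)]
          calc 2 * (A + 1) * (v - u) ≤ 2 * (A + 1) * η := by gcongr
            _ = ρ / 2 := by rw [hη]; field_simp; norm_num
            _ < ρ := by linarith)
      rw [hvc] at this
      have e : x - (T - u) * c = x - (T - v) * c - (v - u) * c := by ring
      rw [e, this]
  obtain ⟨n, hn⟩ := exists_nat_ge ((T - s) / η)
  exact key n s ⟨le_rfl, hsT⟩ ((div_le_iff₀ hη0).1 hn)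

/-- The one-sided Lipschitz bound of Oleinik. -/
lemma oleinik (h : IsBurgersOn w (Icc a b))
    (hc : ContinuousOn (Function.uncurry w) (Icc a b ×ˢ Icc l r)) {A t x y : ℝ} (hA0 : 0 ≤ A)
    (hA : ∀ t ∈ Icc a b, ∀ x ∈ Icc l r, |w t x| ≤ A) (ht : t ∈ Icc a b) (hyx : y ≤ x)
    (hy : l < y - A * (t - a)) (hx : x + A * (t - a) < r) :
    (t - a) * (w t x - w t y) ≤ x - y := by
  by_contra! hcon
  have hta : 0 ≤ t - a := by linarith [ht.1]
  have hAt := mul_nonneg hA0 hta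
  have hxm : x ∈ Ioo l r := ⟨by linarith, by linarith⟩
  have hym : y ∈ Ioo l r := ⟨by linarith, by linarith⟩
  have hD : 0 < w t x - w t y := by
    by_contra! hle
    have := mul_nonpos_of_nonneg_of_nonpos hta hle
    linarith
  set d := (x - y) / (w t x - w t y) with hd
  have hd0 : 0 ≤ d := div_nonneg (by linarith) hD.le
  have hdt : d < t - a := (div_lt_iff₀ hD).2 hcon
  have hbd : ∀ z ∈ Ioo l r, |d * w t z| ≤ A * (t - a) := fun z hz => by
    rw [abs_mul, abs_of_nonneg hd0, mul_comm]
    exact mul_le_mul (hA t ht z ⟨hz.1.le, hz.2.le⟩) hdt.le hd0 hA0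
  have bx := abs_le.1 (hbd x hxm)
  have bdy := abs_le.1 (hbd y hym)
  have hcross : x - d * w t x = y - d * w t y := by
    have : d * (w t x - w t y) = x - y := div_mul_cancel₀ _ hD.ne'
    linarith
  have key : ∀ z ∈ Ioo l r, z - d * w t z ∈ Ioo l r → w (t - d) (z - d * w t z) = w t z := by
    intro z hz hz'
    have := h.const_along_line hc (s := t - d) (T := t) (x := z) (by linarith) (by linarith) ht.2
      hz (by simpa using hz')
    simpa using this
  have ex := key x hxm ⟨by linarith, by linarith⟩
  have ey := key y hym ⟨by linarith, by linarith⟩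
  rw [hcross, ey] at ex
  linarith

/-- One-sided Lipschitz bounds from above are propagated. -/
lemma lipschitz_upper (h : IsBurgersOn w (Icc a b))
    (hc : ContinuousOn (Function.uncurry w) (Icc a b ×ˢ Icc l r))
    {A K t x y : ℝ} (hK : 0 ≤ K) (hA0 : 0 ≤ A)
    (hA : ∀ t ∈ Icc a b, ∀ x ∈ Icc l r, |w t x| ≤ A) (ht : t ∈ Icc a b) (hyx : y ≤ x)
    (hy : l < y - A * (t - a)) (hx : x + A * (t - a) < r)
    (hini : ∀ y x, l ≤ y → y ≤ x → x ≤ r → w a x - w a y ≤ K * (x - y)) :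
    w t x - w t y ≤ K * (x - y) := by
  have hol := h.oleinik hc hA0 hA ht hyx hy hx
  have hta : 0 ≤ t - a := by linarith [ht.1]
  by_cases hD : w t x - w t y ≤ 0
  · exact hD.trans (mul_nonneg hK (by linarith))
  have hAt := mul_nonneg hA0 hta
  have hxm : x ∈ Ioo l r := ⟨by linarith, by linarith⟩
  have hym : y ∈ Ioo l r := ⟨by linarith, by linarith⟩
  have hbd : ∀ z ∈ Ioo l r, |(t - a) * w t z| ≤ A * (t - a) := fun z hz => by
    rw [abs_mul, abs_of_nonneg hta, mul_comm]
    exact mul_le_mul_of_nonneg_right (hA t ht z ⟨hz.1.le, hz.2.le⟩) hta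
  have bx := abs_le.1 (hbd x hxm)
  have bdy := abs_le.1 (hbd y hym)
  have ex := h.const_along_line hc le_rfl ht.1 ht.2 hxm ⟨by linarith, by linarith⟩
  have ey := h.const_along_line hc le_rfl ht.1 ht.2 hym ⟨by linarith, by linarith⟩
  have := hini (y - (t - a) * w t y) (x - (t - a) * w t x) (by linarith) (by linarith)
    (by linarith)
  rw [ex, ey] at this
  push Not at hD
  nlinarith [mul_nonneg hK (mul_nonneg hta hD.le)]

lemma bound (h : IsBurgersOn w (Icc a b))
    (hc : ContinuousOn (Function.uncurry w) (Icc a b ×ˢ Icc l r))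
    {τ N : ℝ} (hlr : l ≤ r) (hτ : 0 ≤ τ) (hN : 0 < N)
    (ha : ∀ x ∈ Icc l r, τ * (|w a x| - N) ≤ 0)
    (hl : ∀ t ∈ Icc a b, |w t l| ≤ N) (hr : ∀ t ∈ Icc a b, |w t r| ≤ N) :
    ∀ t ∈ Icc a b, ∀ x ∈ Icc l r, (τ + (t - a)) * (|w t x| - N) ≤ r - l := by
  intro t ht x hx
  have h1 := h.bound_aux hc (e := l) hlr (Or.inl rfl) hτ hN (fun x hx => by linarith [hx.1])
    (fun x hx => by
      have := mul_le_mul_of_nonneg_left (sub_le_sub_right (le_abs_self (w a x)) N) hτ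
      linarith [ha x hx, hx.1]) hl hr t ht x hx
  have h2 := h.bound_aux hc (e := -r) hlr (Or.inr rfl) hτ hN (fun x hx => by linarith [hx.2])
    (fun x hx => by
      have := mul_le_mul_of_nonneg_left (sub_le_sub_right (neg_le_abs (w a x)) N) hτ
      linarith [ha x hx, hx.2]) hl hr t ht x hx
  rcases abs_cases (w t x) with ⟨e, -⟩ | ⟨e, -⟩ <;> rw [e]
  · linarith [hx.2]
  · linarith [hx.1]

/-- Boundedness between two times, without control at these times. -/
lemma exists_bound_Ioo (h : IsBurgersOn w (Icc a b)) (hab : a < b) (hlr : l ≤ r)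
    (hc : ∀ c d, a < c → d < b → ContinuousOn (Function.uncurry w) (Icc c d ×ˢ Icc l r)) :
    ∃ A, 0 ≤ A ∧ ∀ t ∈ Ioo a b, ∀ x ∈ Icc l r, |w t x| ≤ A := by
  obtain ⟨N₁, hN₁⟩ := isCompact_Icc.exists_bound_of_continuousOn (h.continuousOn_time l)
  obtain ⟨N₂, hN₂⟩ := isCompact_Icc.exists_bound_of_continuousOn (h.continuousOn_time r)
  obtain ⟨N, hN, hNl, hNr⟩ : ∃ N, 0 < N ∧ (∀ t ∈ Icc a b, |w t l| ≤ N) ∧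
      ∀ t ∈ Icc a b, |w t r| ≤ N :=
    ⟨|N₁| + |N₂| + 1, by positivity,
      fun t ht => (hN₁ t ht).trans (by linarith [le_abs_self N₁, abs_nonneg N₂]),
      fun t ht => (hN₂ t ht).trans (by linarith [le_abs_self N₂, abs_nonneg N₁])⟩
  have hd : 0 < b - a := by linarith
  refine ⟨N + 4 * (r - l) / (b - a),
    add_nonneg hN.le (div_nonneg (by linarith) hd.le), fun t ht x hx => ?_⟩
  have key : (b - a) / 4 * (|w t x| - N) ≤ r - l := by
    by_cases hle : |w t x| ≤ N
    · nlinarith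
    push Not at hle
    rcases le_total ((b - a) / 2) (t - a) with hcase | hcase
    · have hsub : Icc ((a + t) / 2) t ⊆ Icc a b :=
        Icc_subset_Icc (by linarith [ht.1]) ht.2.le
      have := (h.mono hsub).bound (hc _ _ (by linarith [ht.1]) ht.2) hlr le_rfl hN
        (fun x _ => by simp) (fun t ht => hNl t (hsub ht)) (fun t ht => hNr t (hsub ht))
        t ⟨by linarith [ht.1], le_rfl⟩ x hx
      nlinarith
    · have hsub : Icc t ((t + b) / 2) ⊆ Icc a b :=
        Icc_subset_Icc ht.1.le (by linarith [ht.2])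
      have hrev : ∀ u ∈ Icc t ((t + b) / 2), t + (t + b) / 2 - u ∈ Icc a b := fun u hu =>
        hsub ⟨by linarith [hu.2], by linarith [hu.1]⟩
      have := (h.mono hsub).reverse.bound
        (continuousOn_reverse (hc t ((t + b) / 2) ht.1 (by linarith [ht.2]))
          (by ring) (by ring)) hlr le_rfl hN
        (fun x _ => by simp) (fun u hu => by simpa using hNl _ (hrev u hu))
        (fun u hu => by simpa using hNr _ (hrev u hu))
        ((t + b) / 2) ⟨by linarith [ht.2], le_rfl⟩ x hx
      simp only [abs_neg, add_sub_cancel_right] at this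
      nlinarith
  rw [← sub_le_iff_le_add', le_div_iff₀ hd]
  linarith

lemma continuousWithinAt_left (h : IsBurgersOn w (Icc a b)) (hab : a < b)
    (hc : ∀ c d, a < c → d < b → ContinuousOn (Function.uncurry w) (Icc c d ×ˢ Icc l r))
    {x₀ : ℝ} (hx₀ : x₀ ∈ Ioo l r) :
    ContinuousWithinAt (Function.uncurry w) (Icc a b ×ˢ Icc l r) (a, x₀) := by
  obtain ⟨A, hA0, hA⟩ := h.exists_bound_Ioo hab (hx₀.1.trans hx₀.2).le hc
  obtain ⟨δ, hδ, hδl, hδr⟩ : ∃ δ > 0, l + 2 * δ ≤ x₀ ∧ x₀ + 2 * δ ≤ r := by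
    refine ⟨min (x₀ - l) (r - x₀) / 2, half_pos (lt_min (by linarith [hx₀.1])
      (by linarith [hx₀.2])), ?_, ?_⟩
    · linarith [min_le_left (x₀ - l) (r - x₀)]
    · linarith [min_le_right (x₀ - l) (r - x₀)]
  obtain ⟨η, hη, hηA, hηb⟩ : ∃ η > 0, A * η < δ ∧ a + 2 * η < b := by
    refine ⟨min (δ / (2 * (A + 1))) ((b - a) / 4), lt_min (by positivity) (by linarith), ?_, ?_⟩
    · calc A * min (δ / (2 * (A + 1))) ((b - a) / 4) ≤ (A + 1) * (δ / (2 * (A + 1))) := by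
            gcongr
            · linarith
            · exact min_le_left _ _
        _ = δ / 2 := by field_simp
        _ < δ := by linarith
    · linarith [min_le_right (δ / (2 * (A + 1))) ((b - a) / 4)]
  have slope : ∀ t ∈ Ioc a (a + η), ∀ y x, x₀ - δ ≤ y → y ≤ x → x ≤ x₀ + δ →
      w t y - w t x ≤ (x - y) / η := by
    intro t ht y x hy hyx hx
    have hsub : Icc t (t + η) ⊆ Icc a b := Icc_subset_Icc ht.1.le (by linarith [ht.2])
    have := (h.mono hsub).reverse.oleinik (A := A)
      (continuousOn_reverse (hc t (t + η) ht.1 (by linarith [ht.2])) (by ring) (by ring)) hA0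
      (fun u hu z hz => by
        rw [abs_neg]
        exact hA _ ⟨by linarith [hu.2, ht.1], by linarith [hu.1, ht.2]⟩ z hz)
      (t := t + η) ⟨by linarith, le_rfl⟩ hyx (by linarith) (by linarith)
    simp only [add_sub_cancel_right, add_sub_cancel_left] at this
    rw [le_div_iff₀ hη]
    linarith
  have haI : a ∈ Icc a b := ⟨le_rfl, hab.le⟩
  rw [Metric.continuousWithinAt_iff]
  intro ε hε
  obtain ⟨ρ₀, hρ₀, hρ₀'⟩ := Metric.continuousAt_iff.1
    ((h.1 a haI).continuous.continuousAt (x := x₀)) (ε / 3) (by linarith)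
  obtain ⟨ρ, hρ, hρ1, hρ2, hρ3⟩ : ∃ ρ > 0, ρ < ρ₀ ∧ ρ ≤ δ ∧ 2 * ρ / η < ε / 3 := by
    refine ⟨min (ρ₀ / 2) (min δ (ε * η / 12)), by positivity, ?_, ?_, ?_⟩
    · linarith [min_le_left (ρ₀ / 2) (min δ (ε * η / 12))]
    · exact (min_le_right _ _).trans (min_le_left _ _)
    · rw [div_lt_iff₀ hη]
      have := (min_le_right (ρ₀ / 2) (min δ (ε * η / 12))).trans (min_le_right _ _)
      nlinarith [mul_pos hε hη]
  have hspace : ∀ x, |x - x₀| ≤ ρ → |w a x - w a x₀| < ε / 3 := fun x hx => by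
    have := hρ₀' (x := x) (by rw [Real.dist_eq]; linarith)
    rwa [Real.dist_eq] at this
  have htime : ∀ x, ∃ θ > 0, ∀ t, |t - a| < θ → |w t x - w a x| < ε / 3 := fun x => by
    obtain ⟨θ, hθ, hθ'⟩ := Metric.continuousAt_iff.1 (h.2 a haI x).continuousAt (ε / 3)
      (by linarith)
    refine ⟨θ, hθ, fun t ht => ?_⟩
    have := hθ' (x := t) (by rwa [Real.dist_eq])
    rwa [Real.dist_eq] at this
  obtain ⟨θ₁, hθ₁, hθ₁'⟩ := htime (x₀ - ρ)
  obtain ⟨θ₂, hθ₂, hθ₂'⟩ := htime (x₀ + ρ)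
  refine ⟨min ρ (min η (min θ₁ θ₂)), by positivity, ?_⟩
  rintro ⟨t, x⟩ ⟨ht, hx⟩ hdist
  simp only at ht hx
  simp only [Prod.dist_eq, Real.dist_eq, lt_min_iff, max_lt_iff] at hdist
  obtain ⟨⟨-, hx1⟩, ⟨ht2, -⟩, ⟨ht3, -⟩, ht4, -⟩ := hdist
  simp only [Function.uncurry, Real.dist_eq]
  rcases ht.1.eq_or_lt with rfl | hat
  · linarith [hspace x hx1.le]
  have hxx := abs_lt.1 hx1
  have htI : t ∈ Ioc a (a + η) := ⟨hat, by linarith [(abs_lt.1 ht2).2]⟩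
  have s1 := slope t htI x (x₀ + ρ) (by linarith) (by linarith) (by linarith)
  have s2 := slope t htI (x₀ - ρ) x (by linarith) (by linarith) (by linarith)
  have s3 : (x₀ + ρ - x) / η ≤ 2 * ρ / η := by gcongr; linarith
  have s4 : (x - (x₀ - ρ)) / η ≤ 2 * ρ / η := by gcongr; linarith
  have s5 := abs_lt.1 (hθ₁' t ht3)
  have s6 := abs_lt.1 (hθ₂' t ht4)
  have s7 := abs_lt.1 (hspace (x₀ - ρ) (by simp [abs_of_pos hρ]))
  have s8 := abs_lt.1 (hspace (x₀ + ρ) (by simp [abs_of_pos hρ]))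
  rw [abs_lt]
  constructor <;> linarith

/-- Joint continuity on an open time interval extends to its end points. -/
lemma continuousOn_of_Ioo (h : IsBurgersOn w (Icc a b)) (hab : a < b)
    (hc : ∀ c d, a < c → d < b → ContinuousOn (Function.uncurry w) (Icc c d ×ˢ Icc l r)) :
    ContinuousOn (Function.uncurry w) (Icc a b ×ˢ Ioo l r) := by
  rintro ⟨t, x⟩ ⟨ht, hx⟩
  simp only at ht hx
  rcases ht.1.eq_or_lt with rfl | hat
  · exact (h.continuousWithinAt_left hab hc hx).mono (prod_mono le_rfl Ioo_subset_Icc_self)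
  rcases ht.2.eq_or_lt with rfl | htb
  · have h1 := h.reverse.continuousWithinAt_left hab (l := l) (r := r) (x₀ := x)
      (fun c d hca hdb => continuousOn_reverse
        (hc (a + t - d) (a + t - c) (by linarith) (by linarith)) rfl rfl) hx
    have h2 : ContinuousWithinAt (fun p : ℝ × ℝ => ((a + t - p.1, p.2) : ℝ × ℝ))
        (Icc a t ×ˢ Ioo l r) (t, x) := by fun_prop
    have h3 := (ContinuousWithinAt.comp
      (g := Function.uncurry fun u y => -w (a + t - u) y)
      (f := fun p : ℝ × ℝ => ((a + t - p.1, p.2) : ℝ × ℝ))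
      (s := Icc a t ×ˢ Ioo l r) (x := (t, x)) (t := Icc a t ×ˢ Icc l r)
      (by rwa [add_sub_cancel_right]) h2 (by
        rintro ⟨u, y⟩ ⟨hu, hy⟩
        exact ⟨⟨by simp only; linarith [hu.2], by simp only; linarith [hu.1]⟩,
          Ioo_subset_Icc_self hy⟩)).neg
    refine h3.congr ?_ ?_
    · rintro ⟨u, y⟩ -
      simp [Function.uncurry]
    · simp [Function.uncurry]
  · have h1 := hc ((a + t) / 2) ((t + b) / 2) (by linarith) (by linarith) (t, x)
      ⟨⟨by simp only; linarith, by simp only; linarith⟩, Ioo_subset_Icc_self hx⟩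
    refine (h1.continuousAt ?_).continuousWithinAt
    exact prod_mem_nhds (Icc_mem_nhds (by linarith) (by linarith))
      (Icc_mem_nhds hx.1 hx.2)

/-- Lipschitz bounds at two times extend to all intermediate times. -/
lemma lipschitz_of_endpoints (h : IsBurgersOn w (Icc a b)) (hab : a < b) {x₀ ρ N K : ℝ}
    (hρ : 0 < ρ) (hN : 0 < N) (hK : 0 ≤ K)
    (hc : ∀ c d, a < c → d < b →
      ContinuousOn (Function.uncurry w) (Icc c d ×ˢ Icc (x₀ - ρ) (x₀ + ρ)))
    (hl : ∀ t ∈ Icc a b, |w t (x₀ - ρ / 2)| ≤ N) (hr : ∀ t ∈ Icc a b, |w t (x₀ + ρ / 2)| ≤ N)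
    (ha : ∀ x ∈ Icc (x₀ - ρ) (x₀ + ρ), |w a x| ≤ N)
    (hLa : ∀ x ∈ Icc (x₀ - ρ) (x₀ + ρ), ∀ y ∈ Icc (x₀ - ρ) (x₀ + ρ),
      |w a x - w a y| ≤ K * |x - y|)
    (hLb : ∀ x ∈ Icc (x₀ - ρ) (x₀ + ρ), ∀ y ∈ Icc (x₀ - ρ) (x₀ + ρ),
      |w b x - w b y| ≤ K * |x - y|)
    (hsmall : (N + ρ) * (b - a) < ρ / 4) :
    ∀ t ∈ Icc a b, ∀ x ∈ Icc (x₀ - ρ / 4) (x₀ + ρ / 4), ∀ y ∈ Icc (x₀ - ρ / 4) (x₀ + ρ / 4),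
      |w t x - w t y| ≤ K * |x - y| := by
  have hsub : Icc (x₀ - ρ / 2) (x₀ + ρ / 2) ⊆ Icc (x₀ - ρ) (x₀ + ρ) :=
    Icc_subset_Icc (by linarith) (by linarith)
  have hcont : ContinuousOn (Function.uncurry w) (Icc a b ×ˢ Icc (x₀ - ρ / 2) (x₀ + ρ / 2)) :=
    (h.continuousOn_of_Ioo hab hc).mono
      (prod_mono le_rfl (Icc_subset_Ioo (by linarith) (by linarith)))
  have hA : ∀ t ∈ Icc a b, ∀ x ∈ Icc (x₀ - ρ / 2) (x₀ + ρ / 2), |w t x| ≤ N + ρ := by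
    intro t ht x hx
    have := h.bound hcont (τ := 1) (by linarith) zero_le_one hN
      (fun x hx => by linarith [ha x (hsub hx)]) hl hr t ht x hx
    by_contra! hcon
    nlinarith [ht.1]
  have hN0 : 0 ≤ N + ρ := by linarith
  have hord : ∀ t ∈ Icc a b, ∀ y x, x₀ - ρ / 4 ≤ y → y ≤ x → x ≤ x₀ + ρ / 4 →
      |w t x - w t y| ≤ K * |x - y| := by
    intro t ht y x hy hyx hx
    have ht1 := mul_le_mul_of_nonneg_left (sub_le_sub_right ht.2 a) hN0
    have ht2 := mul_le_mul_of_nonneg_left (sub_le_sub_left ht.1 b) hN0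
    have h1 := h.lipschitz_upper hcont hK hN0 hA ht hyx (by linarith) (by linarith)
      (fun y x hy hyx hx => by
        have := hLa x (hsub ⟨by linarith, hx⟩) y (hsub ⟨hy, by linarith⟩)
        rw [abs_of_nonneg (sub_nonneg.2 hyx)] at this
        exact (le_abs_self _).trans this)
    have h2 := h.reverse.lipschitz_upper (continuousOn_reverse hcont (by ring) (by ring)) hK hN0
      (fun u hu z hz => by
        rw [abs_neg]
        exact hA _ ⟨by linarith [hu.2], by linarith [hu.1]⟩ z hz)
      (t := a + b - t) ⟨by linarith [ht.2], by linarith [ht.1]⟩ hyx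
      (by linarith) (by linarith)
      (fun y x hy hyx hx => by
        have := hLb x (hsub ⟨by linarith, hx⟩) y (hsub ⟨hy, by linarith⟩)
        rw [abs_of_nonneg (sub_nonneg.2 hyx)] at this
        simp only [add_sub_cancel_left]
        linarith [(neg_le_abs _).trans this])
    simp only [sub_sub_cancel] at h2
    rw [abs_of_nonneg (sub_nonneg.2 hyx), abs_le]
    constructor <;> linarith
  intro t ht x hx y hy
  rcases le_total y x with hyx | hyx
  · exact hord t ht y x hy.1 hyx hx.2
  · rw [abs_sub_comm, abs_sub_comm x]
    exact hord t ht x y hx.1 hyx hy.2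

lemma continuousOn_of_lipschitz_on_closed (h : IsBurgersOn w (Icc a b))
    {P : Set ℝ} (hP : IsCompact P) (hPne : P.Nonempty) (hPs : P ⊆ Icc a b)
    {x₀ ρ N K : ℝ} (hρ : 0 < ρ) (hN : 0 < N) (hK : 0 ≤ K)
    (hc : ∀ c d, a ≤ c → d ≤ b → Disjoint (Icc c d) P →
      ContinuousOn (Function.uncurry w) (Icc c d ×ˢ Icc (x₀ - ρ) (x₀ + ρ)))
    (hl : ∀ t ∈ Icc a b, |w t (x₀ - ρ / 2)| ≤ N)
    (hr : ∀ t ∈ Icc a b, |w t (x₀ + ρ / 2)| ≤ N)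
    (hPN : ∀ t ∈ P, ∀ x ∈ Icc (x₀ - ρ) (x₀ + ρ), |w t x| ≤ N)
    (hPL : ∀ t ∈ P, ∀ x ∈ Icc (x₀ - ρ) (x₀ + ρ), ∀ y ∈ Icc (x₀ - ρ) (x₀ + ρ),
      |w t x - w t y| ≤ K * |x - y|)
    (hsmall : (N + ρ) * (b - a) < ρ / 4) :
    ContinuousOn (Function.uncurry w) (Icc a b ×ˢ Icc (x₀ - ρ / 4) (x₀ + ρ / 4)) := by
  obtain ⟨b1, hb1P, hb1⟩ := hP.exists_isLeast hPne
  obtain ⟨b2, hb2P, hb2⟩ := hP.exists_isGreatest hPne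
  have hb12 : b1 ≤ b2 := hb1 hb2P
  have hJ : Icc (x₀ - ρ / 4) (x₀ + ρ / 4) ⊆ Icc (x₀ - ρ) (x₀ + ρ) :=
    Icc_subset_Icc (by linarith) (by linarith)
  have hJ' : Icc (x₀ - ρ / 4) (x₀ + ρ / 4) ⊆ Ioo (x₀ - ρ) (x₀ + ρ) :=
    Icc_subset_Ioo (by linarith) (by linarith)
  have hLip : ∀ t ∈ Icc b1 b2, ∀ x ∈ Icc (x₀ - ρ / 4) (x₀ + ρ / 4),
      ∀ y ∈ Icc (x₀ - ρ / 4) (x₀ + ρ / 4), |w t x - w t y| ≤ K * |x - y| := by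
    intro t ht
    by_cases htP : t ∈ P
    · exact fun x hx y hy => hPL t htP x (hJ hx) y (hJ hy)
    obtain ⟨c, ⟨hcP, hct⟩, hcg⟩ :=
      (hP.inter_right isClosed_Iic).exists_isGreatest ⟨b1, hb1P, ht.1⟩
    obtain ⟨d, ⟨hdP, htd⟩, hdl⟩ :=
      (hP.inter_right isClosed_Ici).exists_isLeast ⟨b2, hb2P, ht.2⟩
    simp only [mem_Iic] at hct
    simp only [mem_Ici] at htd
    have hct' : c < t := lt_of_le_of_ne hct fun e => htP (e ▸ hcP)
    have htd' : t < d := lt_of_le_of_ne htd fun e => htP (e ▸ hdP)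
    have hac := (hPs hcP).1
    have hdb := (hPs hdP).2
    have hsub : Icc c d ⊆ Icc a b := Icc_subset_Icc hac hdb
    refine lipschitz_of_endpoints (h.mono hsub) (hct'.trans htd') hρ hN hK ?_
      (fun s hs => hl s (hsub hs)) (fun s hs => hr s (hsub hs)) (hPN c hcP) (hPL c hcP)
      (hPL d hdP) ?_ t ⟨hct, htd⟩
    · intro c' d' hc' hd'
      refine hc c' d' (by linarith) (by linarith) (Set.disjoint_left.2 fun s hs hsP => ?_)
      rcases le_total s t with hst | hst
      · have := hcg ⟨hsP, hst⟩
        linarith [hs.1]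
      · have := hdl ⟨hsP, hst⟩
        linarith [hs.2]
    · have : (N + ρ) * (d - c) ≤ (N + ρ) * (b - a) := by gcongr
      linarith
  have hmid : ContinuousOn (Function.uncurry w)
      (Icc b1 b2 ×ˢ Icc (x₀ - ρ / 4) (x₀ + ρ / 4)) := by
    refine continuousOn_prod_of_continuousOn_lipschitzOnWith' _ ⟨K, hK⟩ ?_ ?_
    · intro t ht
      refine LipschitzOnWith.of_dist_le_mul fun x hx y hy => ?_
      exact hLip t ht x hx y hy
    · intro x _
      exact (h.continuousOn_time x).mono (Icc_subset_Icc (hPs hb1P).1 (hPs hb2P).2)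
  have hleft : ContinuousOn (Function.uncurry w)
      (Icc a b1 ×ˢ Icc (x₀ - ρ / 4) (x₀ + ρ / 4)) := by
    rcases (hPs hb1P).1.eq_or_lt with e | hlt
    · refine hmid.mono (prod_mono ?_ subset_rfl)
      rw [e]; exact Icc_subset_Icc le_rfl hb12
    · refine (continuousOn_of_Ioo (h.mono (Icc_subset_Icc le_rfl (hPs hb1P).2)) hlt ?_).mono
        (prod_mono subset_rfl hJ')
      intro c d hac hd
      refine hc c d hac.le (by linarith [(hPs hb1P).2]) (Set.disjoint_left.2 fun s hs hsP => ?_)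
      linarith [hb1 hsP, hs.2]
  have hright : ContinuousOn (Function.uncurry w)
      (Icc b2 b ×ˢ Icc (x₀ - ρ / 4) (x₀ + ρ / 4)) := by
    rcases (hPs hb2P).2.eq_or_lt with e | hlt
    · refine hmid.mono (prod_mono ?_ subset_rfl)
      rw [← e]; exact Icc_subset_Icc hb12 le_rfl
    · refine (continuousOn_of_Ioo (h.mono (Icc_subset_Icc (hPs hb2P).1 le_rfl)) hlt ?_).mono
        (prod_mono subset_rfl hJ')
      intro c d hac hd
      refine hc c d (by linarith [(hPs hb2P).1]) hd.le (Set.disjoint_left.2 fun s hs hsP => ?_)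
      linarith [hb2 hsP, hs.1]
  have hu := (hleft.union_of_isClosed hmid (isClosed_Icc.prod isClosed_Icc)
    (isClosed_Icc.prod isClosed_Icc)).union_of_isClosed hright
    ((isClosed_Icc.prod isClosed_Icc).union (isClosed_Icc.prod isClosed_Icc))
    (isClosed_Icc.prod isClosed_Icc)
  refine hu.mono ?_
  rintro ⟨t, x⟩ ⟨ht, hx⟩
  rcases le_total t b1 with h1 | h1
  · exact Or.inl (Or.inl ⟨⟨ht.1, h1⟩, hx⟩)
  rcases le_total t b2 with h2 | h2
  · exact Or.inl (Or.inr ⟨⟨h1, h2⟩, hx⟩)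
  · exact Or.inr ⟨⟨h2, ht.2⟩, hx⟩

lemma continuousOn_uncurry (h : IsBurgersOn w (Ici 0)) :
    ContinuousOn (Function.uncurry w) (Ici 0 ×ˢ univ) := by
  set S : Set (ℝ × ℝ) := Ici 0 ×ˢ univ with hS
  have hSc : IsClosed S := isClosed_Ici.prod isClosed_univ
  set O : Set (ℝ × ℝ) := {p | ∃ U ∈ 𝓝 p, ContinuousOn (Function.uncurry w) (U ∩ S)} with hO
  have hOo : IsOpen O := by
    refine isOpen_iff_mem_nhds.2 fun p ⟨U, hU, hUc⟩ => ?_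
    filter_upwards [eventually_mem_nhds_iff.2 hU] with q hq
    exact ⟨U, hq, hUc⟩
  have hOat : ∀ p ∈ O, p ∈ S → ContinuousWithinAt (Function.uncurry w) S p := by
    rintro p ⟨U, hU, hUc⟩ hp
    exact (continuousWithinAt_inter' (mem_nhdsWithin_of_mem_nhds hU)).1
      (by rw [inter_comm]; exact hUc p ⟨mem_of_mem_nhds hU, hp⟩)
  set B : Set (ℝ × ℝ) := S \ O with hB
  have hBc : IsClosed B := hSc.sdiff hOo
  rcases B.eq_empty_or_nonempty with hBe | hBne
  · intro p hp
    refine hOat p ?_ hp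
    by_contra hpO
    exact (hBe ▸ (⟨hp, hpO⟩ : p ∈ B) : p ∈ (∅ : Set (ℝ × ℝ)))
  exfalso
  have := hBne.to_subtype
  have := hBc.completeSpace_coe
  let F : ℕ → Set B := fun n => {p | ∀ y z, |y - p.1.2| < 1 / ((n : ℝ) + 1) →
    |z - p.1.2| < 1 / ((n : ℝ) + 1) → |w p.1.1 y - w p.1.1 z| ≤ n * |y - z|}
  have hFc : ∀ n, IsClosed (F n) := by
    intro n
    refine IsSeqClosed.isClosed fun u p hu hup y z hy hz => ?_
    have h1 : Tendsto (fun i => ((u i : B) : ℝ × ℝ).1) atTop (𝓝 p.1.1) :=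
      ((continuous_fst.comp continuous_subtype_val).tendsto p).comp hup
    have h2 : Tendsto (fun i => ((u i : B) : ℝ × ℝ).2) atTop (𝓝 p.1.2) :=
      ((continuous_snd.comp continuous_subtype_val).tendsto p).comp hup
    have hw : ∀ y, Tendsto (fun i => w (u i).1.1 y) atTop (𝓝 (w p.1.1 y)) := by
      intro y
      exact (h.2 p.1.1 p.2.1.1 y).continuousAt.tendsto.comp h1
    refine le_of_tendsto ((hw y).sub (hw z)).abs ?_
    have hy' := (tendsto_const_nhds (x := y)).sub h2 |>.abs.eventually_lt_const hy
    have hz' := (tendsto_const_nhds (x := z)).sub h2 |>.abs.eventually_lt_const hz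
    filter_upwards [hy', hz'] with i hyi hzi
    exact hu i y z hyi hzi
  have hFu : ⋃ n, F n = univ := by
    refine eq_univ_of_forall fun p => ?_
    obtain ⟨L, T, hT, hL⟩ := (h.1 p.1.1 p.2.1.1).locallyLipschitz p.1.2
    obtain ⟨ε, hε, hεT⟩ := Metric.mem_nhds_iff.1 hT
    obtain ⟨n, hn⟩ := exists_nat_gt (max (L : ℝ) (1 / ε))
    have hnL : (L : ℝ) ≤ n := (le_max_left _ _).trans hn.le
    have hnε : 1 / ((n : ℝ) + 1) < ε := by
      have h1 : 1 / ε < n := (le_max_right _ _).trans_lt hn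
      rw [div_lt_iff₀ hε] at h1
      rw [div_lt_iff₀ (by positivity)]
      nlinarith
    refine mem_iUnion.2 ⟨n, fun y z hy hz => ?_⟩
    have := hL.dist_le_mul y (hεT (by rw [Metric.mem_ball, Real.dist_eq]; linarith)) z
      (hεT (by rw [Metric.mem_ball, Real.dist_eq]; linarith))
    rw [Real.dist_eq, Real.dist_eq] at this
    exact this.trans (by gcongr)
  obtain ⟨n, p₀, hp₀⟩ := nonempty_interior_of_iUnion_of_closed hFc hFu
  obtain ⟨ε, hε, hεF⟩ := Metric.mem_nhds_iff.1 (mem_interior_iff_mem_nhds.1 hp₀)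
  obtain ⟨⟨t₀, x₀⟩, hpB⟩ := p₀
  have ht₀ : 0 ≤ t₀ := hpB.1.1
  obtain ⟨ρ, hρ, hρε, hρn⟩ : ∃ ρ : ℝ, 0 < ρ ∧ ρ < ε ∧ 2 * ρ < 1 / ((n : ℝ) + 1) := by
    refine ⟨min (ε / 2) (1 / ((n : ℝ) + 1) / 3), by positivity, ?_, ?_⟩
    · exact (min_le_left _ _).trans_lt (by linarith)
    · have h1 := min_le_right (ε / 2) (1 / ((n : ℝ) + 1) / 3)
      have h2 : 0 < 1 / ((n : ℝ) + 1) := by positivity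
      linarith
  have hBL : ∀ p ∈ B, |p.1 - t₀| < ε → p.2 ∈ Icc (x₀ - ρ) (x₀ + ρ) →
      ∀ x ∈ Icc (x₀ - ρ) (x₀ + ρ), ∀ y ∈ Icc (x₀ - ρ) (x₀ + ρ),
        |w p.1 x - w p.1 y| ≤ n * |x - y| := by
    intro p hp hpt hpx x hx y hy
    refine (show (⟨p, hp⟩ : B) ∈ F n from hεF ?_) x y ?_ ?_
    · rw [Metric.mem_ball, Subtype.dist_eq, Prod.dist_eq, Real.dist_eq, Real.dist_eq]
      refine max_lt hpt (lt_of_le_of_lt (abs_le.2 ⟨?_, ?_⟩) hρε)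
      · linarith [hpx.1]
      · linarith [hpx.2]
    · refine lt_of_le_of_lt (abs_le.2 ⟨?_, ?_⟩) hρn
      · linarith [hpx.2, hx.1]
      · linarith [hpx.1, hx.2]
    · refine lt_of_le_of_lt (abs_le.2 ⟨?_, ?_⟩) hρn
      · linarith [hpx.2, hy.1]
      · linarith [hpx.1, hy.2]
  have hbd : ∀ x, ∃ M, ∀ t ∈ Icc 0 (t₀ + 1), |w t x| ≤ M := fun x =>
    isCompact_Icc.exists_bound_of_continuousOn
      ((h.continuousOn_time x).mono Icc_subset_Ici_self)
  obtain ⟨M1, hM1⟩ := hbd (x₀ - ρ / 2)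
  obtain ⟨M2, hM2⟩ := hbd (x₀ + ρ / 2)
  obtain ⟨M3, hM3⟩ := hbd x₀
  obtain ⟨N, hN, hN1, hN2, hN3⟩ : ∃ N : ℝ, 0 < N ∧ M1 ≤ N ∧ M2 ≤ N ∧ M3 + n * ρ ≤ N :=
    ⟨max 1 (max M1 (max M2 (M3 + n * ρ))), by positivity,
      by simp, by simp, by simp⟩
  obtain ⟨η, hη, hη1, hηε, hηs⟩ :
      ∃ η : ℝ, 0 < η ∧ η ≤ 1 ∧ η < ε ∧ (N + ρ) * (2 * η) < ρ / 4 := by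
    have hNρ : 0 < N + ρ := by linarith
    refine ⟨min 1 (min (ε / 2) (ρ / (16 * (N + ρ)))), by positivity, min_le_left _ _, ?_, ?_⟩
    · exact ((min_le_right _ _).trans (min_le_left _ _)).trans_lt (by linarith)
    · have h1 : min 1 (min (ε / 2) (ρ / (16 * (N + ρ)))) ≤ ρ / (16 * (N + ρ)) :=
        (min_le_right _ _).trans (min_le_right _ _)
      rw [le_div_iff₀ (by positivity)] at h1
      linarith
  set α := max 0 (t₀ - η) with hα
  have hα0 : 0 ≤ α := le_max_left _ _
  have hαη : t₀ - η ≤ α := le_max_right _ _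
  have hαt : α ≤ t₀ := max_le ht₀ (by linarith)
  have hsub : Icc α (t₀ + η) ⊆ Icc 0 (t₀ + 1) := Icc_subset_Icc hα0 (by linarith)
  set Q : Set (ℝ × ℝ) := B ∩ Icc α (t₀ + η) ×ˢ Icc (x₀ - ρ) (x₀ + ρ) with hQ
  have hQc : IsCompact Q := (isCompact_Icc.prod isCompact_Icc).inter_left hBc
  have hPL : ∀ t ∈ Set.image Prod.fst Q, ∀ x ∈ Icc (x₀ - ρ) (x₀ + ρ),
      ∀ y ∈ Icc (x₀ - ρ) (x₀ + ρ), |w t x - w t y| ≤ n * |x - y| := by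
    rintro _ ⟨p, ⟨hp, hp1, hp2⟩, rfl⟩
    refine hBL p hp (lt_of_le_of_lt (abs_le.2 ⟨?_, ?_⟩) hηε) hp2
    · linarith [hp1.1]
    · linarith [hp1.2]
  have hPs : Set.image Prod.fst Q ⊆ Icc α (t₀ + η) := by
    rintro _ ⟨p, ⟨hp, hp1, hp2⟩, rfl⟩
    exact hp1
  have hx₀ : x₀ ∈ Icc (x₀ - ρ) (x₀ + ρ) := ⟨by linarith, by linarith⟩
  have key := continuousOn_of_lipschitz_on_closed (w := w)
    (h.mono ((Icc_subset_Ici_self).trans (Ici_subset_Ici.2 hα0)))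
    (hQc.image continuous_fst)
    ⟨t₀, (t₀, x₀), ⟨hpB, ⟨hαt, by linarith⟩, hx₀⟩, rfl⟩ hPs hρ hN (Nat.cast_nonneg n)
    (fun c d hc hd hdisj p hp => ?_) (fun t ht => (hM1 t (hsub ht)).trans hN1)
    (fun t ht => (hM2 t (hsub ht)).trans hN2) ?_ hPL ?_
  · refine hpB.2 ⟨Ioo (t₀ - η) (t₀ + η) ×ˢ Ioo (x₀ - ρ / 4) (x₀ + ρ / 4),
      prod_mem_nhds (Ioo_mem_nhds (by linarith) (by linarith))
        (Ioo_mem_nhds (by linarith) (by linarith)), key.mono ?_⟩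
    rintro ⟨t, x⟩ ⟨⟨ht, hx⟩, hp, -⟩
    exact ⟨⟨max_le hp ht.1.le, ht.2.le⟩, Ioo_subset_Icc_self hx⟩
  · have hpS : p ∈ S := ⟨hα0.trans (hc.trans hp.1.1), mem_univ _⟩
    refine (hOat p ?_ hpS).mono ?_
    · by_contra hpO
      exact Set.disjoint_left.1 hdisj hp.1
        ⟨p, ⟨⟨hpS, hpO⟩, ⟨hc.trans hp.1.1, hp.1.2.trans hd⟩, hp.2⟩, rfl⟩
    · exact fun q hq => ⟨hα0.trans (hc.trans hq.1.1), mem_univ _⟩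
  · intro t ht x hx
    have h1 := hPL t ht x hx x₀ hx₀
    have h2 := hM3 t (hsub (hPs ht))
    have h3 : |x - x₀| ≤ ρ := abs_le.2 ⟨by linarith [hx.1], by linarith [hx.2]⟩
    have h4 : |w t x| ≤ |w t x - w t x₀| + |w t x₀| := by
      simpa using abs_add_le (w t x - w t x₀) (w t x₀)
    have h5 : (n : ℝ) * |x - x₀| ≤ n * ρ := by gcongr
    linarith
  · have : (N + ρ) * (t₀ + η - α) ≤ (N + ρ) * (2 * η) := by gcongr; linarith
    linarith

/-- The solution is constant along characteristics, so it solves the implicit equation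
`w t x = w 0 (x - t * w t x)`. -/
lemma implicit (h : IsBurgersOn w (Ici 0)) {t : ℝ} (ht : 0 ≤ t) (x : ℝ) :
    w 0 (x - t * w t x) = w t x := by
  have hc := h.continuousOn_uncurry
  have := const_along_line (w := w) (a := 0) (b := t) (s := 0) (T := t)
    (l := min x (x - t * w t x) - 1) (r := max x (x - t * w t x) + 1) (x := x)
    (h.mono Icc_subset_Ici_self)
    (hc.mono (prod_mono Icc_subset_Ici_self (subset_univ _))) le_rfl ht le_rfl
    ⟨by linarith [min_le_left x (x - t * w t x)], by linarith [le_max_left x (x - t * w t x)]⟩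
    ⟨by rw [sub_zero]; linarith [min_le_right x (x - t * w t x)],
      by rw [sub_zero]; linarith [le_max_right x (x - t * w t x)]⟩
  rwa [sub_zero] at this

end IsBurgersOn

lemma Real.hasDerivAt_tanh (x : ℝ) : HasDerivAt Real.tanh (1 - Real.tanh x ^ 2) x := by
  have hfun : Real.tanh = fun y => Real.sinh y / Real.cosh y :=
    funext Real.tanh_eq_sinh_div_cosh
  have hc := (Real.cosh_pos x).ne'
  rw [hfun]
  refine ((Real.hasDerivAt_sinh x).fun_div (Real.hasDerivAt_cosh x) hc).congr_deriv ?_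
  field_simp

lemma Real.tanh_nonneg_of_nonneg {x : ℝ} (hx : 0 ≤ x) : 0 ≤ Real.tanh x := by
  rw [Real.tanh_eq_sinh_div_cosh]
  exact div_nonneg (Real.sinh_nonneg_iff.2 hx) (Real.cosh_pos x).le

lemma Real.tanh_nonpos_of_nonpos {x : ℝ} (hx : x ≤ 0) : Real.tanh x ≤ 0 := by
  have := Real.tanh_nonneg_of_nonneg (neg_nonneg.2 hx)
  rw [Real.tanh_neg] at this
  linarith

lemma lintegral_enorm_le_of_intervalIntegral {f : ℝ → ℝ} (hf : Continuous f) (c I : ℝ)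
    (h : ∀ R, 0 < R → ∫ x in (c - R)..(c + R), |f x| ≤ I) :
    ∫⁻ x, ‖f x‖ₑ ≤ ENNReal.ofReal I := by
  have ha : Tendsto (fun R => c - R) atTop atBot :=
    tendsto_atBot_add_const_left _ _ tendsto_neg_atTop_atBot
  have hb : Tendsto (fun R => c + R) atTop atTop :=
    tendsto_atTop_add_const_left _ _ tendsto_id
  have hev : ∀ᶠ R in atTop, ∫ x in (c - R)..(c + R), ‖f x‖ ≤ I := by
    filter_upwards [eventually_gt_atTop 0] with R hR using h R hR
  have hfint : Integrable f := by
    refine integrable_of_intervalIntegral_norm_bounded I (fun R => ?_) ha hb hev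
    exact (hf.continuousOn.integrableOn_Icc (μ := volume)).mono_set Ioc_subset_Icc_self
  rw [← ofReal_integral_norm_eq_lintegral_enorm hfint]
  exact ENNReal.ofReal_le_ofReal
    (le_of_tendsto (intervalIntegral_tendsto_integral hfint.norm ha hb) hev)

lemma eLpNorm_le_of_bound_of_lintegral {f : ℝ → ℝ} {D e : ℝ} (hD : 0 ≤ D) (he : 0 < e)
    (hsup : ∀ x, |f x| ≤ D / e) (hfint : ∫⁻ x, ‖f x‖ₑ ≤ ENNReal.ofReal D)
    {p : ℝ≥0∞} (hp : 1 ≤ p) :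
    eLpNorm f p volume ≤ ENNReal.ofReal (D * e ^ (-1 + p⁻¹.toReal)) := by
  have hsup' : ∀ x, ‖f x‖ₑ ≤ ENNReal.ofReal (D / e) := fun x => by
    rw [← ofReal_norm]
    exact ENNReal.ofReal_le_ofReal (hsup x)
  rcases eq_or_ne p ∞ with rfl | hpt
  · rw [eLpNorm_exponent_top, ENNReal.inv_top, ENNReal.toReal_zero, add_zero, Real.rpow_neg_one,
      ← div_eq_mul_inv]
    exact eLpNormEssSup_le_of_ae_enorm_bound (Eventually.of_forall hsup')
  have hq : 1 ≤ p.toReal := by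
    rw [← ENNReal.toReal_one]
    exact ENNReal.toReal_mono hpt hp
  have hp0 : p ≠ 0 := (zero_lt_one.trans_le hp).ne'
  rw [eLpNorm_eq_lintegral_rpow_enorm_toReal hp0 hpt, ENNReal.toReal_inv]
  set q := p.toReal
  have hq0 : 0 < q := by linarith
  have h1 : ∫⁻ x, ‖f x‖ₑ ^ q ≤ ENNReal.ofReal ((D / e) ^ (q - 1) * D) := by
    calc ∫⁻ x, ‖f x‖ₑ ^ q ≤ ∫⁻ x, ENNReal.ofReal (D / e) ^ (q - 1) * ‖f x‖ₑ := by
          refine lintegral_mono fun x => ?_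
          calc ‖f x‖ₑ ^ q = ‖f x‖ₑ ^ (q - 1) * ‖f x‖ₑ := by
                conv_lhs => rw [show q = (q - 1) + 1 by ring]
                rw [ENNReal.rpow_add_of_nonneg _ _ (by linarith) zero_le_one, ENNReal.rpow_one]
            _ ≤ _ := by
                gcongr
                exact hsup' x
      _ = ENNReal.ofReal (D / e) ^ (q - 1) * ∫⁻ x, ‖f x‖ₑ := by
          refine lintegral_const_mul' _ _ (ENNReal.rpow_ne_top_of_nonneg (by linarith) ?_)
          exact ENNReal.ofReal_ne_top
      _ ≤ ENNReal.ofReal (D / e) ^ (q - 1) * ENNReal.ofReal D := by gcongr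
      _ = _ := by
          rw [ENNReal.ofReal_rpow_of_nonneg (by positivity) (by linarith),
            ENNReal.ofReal_mul (by positivity)]
  calc (∫⁻ x, ‖f x‖ₑ ^ q) ^ (1 / q)
      ≤ ENNReal.ofReal ((D / e) ^ (q - 1) * D) ^ (1 / q) := by gcongr
    _ = ENNReal.ofReal (((D / e) ^ (q - 1) * D) ^ (1 / q)) :=
        ENNReal.ofReal_rpow_of_nonneg (by positivity) (by positivity)
    _ = ENNReal.ofReal (D * e ^ (-1 + q⁻¹)) := by
        congr 1
        rcases hD.eq_or_lt with rfl | hD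
        · simp [hq0.ne']
        have h2 : (D / e) ^ (q - 1) * D = D ^ q * e ^ (-(q - 1)) := by
          rw [Real.div_rpow hD.le he.le, Real.rpow_neg he.le]
          have : D ^ q = D ^ (q - 1) * D := by
            conv_lhs => rw [show q = (q - 1) + 1 by ring, Real.rpow_add hD, Real.rpow_one]
          rw [this]
          ring
        rw [h2, Real.mul_rpow (by positivity) (by positivity), ← Real.rpow_mul hD.le,
          ← Real.rpow_mul he.le, mul_one_div_cancel hq0.ne', Real.rpow_one]
        congr 2
        field_simp
        ring

lemma lintegral_enorm_deriv_le_of_monotone {f f' : ℝ → ℝ} (hf : ∀ x, HasDerivAt f (f' x) x)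
    (hf' : Continuous f') (hpos : ∀ x, 0 ≤ f' x) {lo hi : ℝ} (hlo : ∀ x, lo ≤ f x)
    (hhi : ∀ x, f x ≤ hi) : ∫⁻ x, ‖f' x‖ₑ ≤ ENNReal.ofReal (hi - lo) := by
  refine lintegral_enorm_le_of_intervalIntegral hf' 0 _ fun R hR => ?_
  simp_rw [abs_of_nonneg (hpos _)]
  rw [intervalIntegral.integral_eq_sub_of_hasDerivAt (fun x _ => hf x)
    (hf'.intervalIntegrable _ _)]
  linarith [hlo (0 - R), hhi (0 + R)]

lemma lintegral_enorm_deriv_le_of_unimodal {f f' : ℝ → ℝ} (hf : ∀ x, HasDerivAt f (f' x) x)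
    (hf' : Continuous f') {c M : ℝ} (hpos : ∀ x ≤ c, 0 ≤ f' x) (hneg : ∀ x, c ≤ x → f' x ≤ 0)
    (hlo : ∀ x, 0 ≤ f x) (hM : ∀ x, f x ≤ M) : ∫⁻ x, ‖f' x‖ₑ ≤ ENNReal.ofReal (2 * M) := by
  refine lintegral_enorm_le_of_intervalIntegral hf' c _ fun R hR => ?_
  rw [← intervalIntegral.integral_add_adjacent_intervals (b := c)
    (hf'.abs.intervalIntegrable _ _) (hf'.abs.intervalIntegrable _ _)]
  have h1 : ∫ x in (c - R)..c, |f' x| = f c - f (c - R) := by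
    rw [← intervalIntegral.integral_eq_sub_of_hasDerivAt (fun x _ => hf x)
      (hf'.intervalIntegrable _ _)]
    refine intervalIntegral.integral_congr fun x hx => abs_of_nonneg (hpos x ?_)
    rw [uIcc_of_le (by linarith)] at hx
    exact hx.2
  have h2 : ∫ x in c..(c + R), |f' x| = -(f (c + R) - f c) := by
    rw [← intervalIntegral.integral_eq_sub_of_hasDerivAt (fun x _ => hf x)
      (hf'.intervalIntegrable _ _), ← intervalIntegral.integral_neg]
    refine intervalIntegral.integral_congr fun x hx => abs_of_nonpos (hneg x ?_)
    rw [uIcc_of_le (by linarith)] at hx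
    exact hx.1
  rw [h1, h2]
  linarith [hlo (c - R), hlo (c + R), hM c]

/-- Derivatives of a solution of the implicit equation `u x = g (x - t * u x)` with a `tanh`
profile `g`. -/
lemma deriv_of_implicit_tanh {u : ℝ → ℝ} (hu : ContDiff ℝ 2 u) {m k δ t : ℝ} (hk : 0 ≤ k)
    (hδ : 0 < δ) (ht : 0 ≤ t) (himp : ∀ x, u x = m + k * Real.tanh ((x - t * u x) / δ)) (x : ℝ) :
    0 ≤ deriv u x ∧ t * deriv u x ≤ 1 ∧ δ * deriv u x ≤ k ∧
      deriv (deriv u) x = -(2 / δ * Real.tanh ((x - t * u x) / δ)) *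
        (deriv u x * (1 - t * deriv u x) ^ 2) := by
  have hu1 : ∀ x, HasDerivAt u (deriv u x) x := fun x =>
    (hu.differentiable (by norm_num) x).hasDerivAt
  have hu2 : ∀ x, HasDerivAt (deriv u) (deriv (deriv u) x) x := fun x =>
    ((contDiff_succ_iff_deriv.1 (show ContDiff ℝ (1 + 1) u by exact_mod_cast hu)).2.2.differentiable
      (by norm_num) x).hasDerivAt
  have hT : ∀ x, HasDerivAt (fun x => Real.tanh ((x - t * u x) / δ))
      ((1 - Real.tanh ((x - t * u x) / δ) ^ 2) * ((1 - t * deriv u x) / δ)) x := fun x =>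
    (Real.hasDerivAt_tanh _).comp x (((hasDerivAt_id x).sub ((hu1 x).const_mul t)).div_const δ)
  have h1 : ∀ x, deriv u x =
      k * ((1 - Real.tanh ((x - t * u x) / δ) ^ 2) * ((1 - t * deriv u x) / δ)) := fun x => by
    have := ((hT x).const_mul k).const_add m
    rw [← funext himp] at this
    exact (hu1 x).unique this
  have h2 := (((hT x).fun_pow 2).const_sub 1).fun_mul
    ((((hu2 x).const_mul t).const_sub 1).div_const δ) |>.const_mul k
  rw [← funext h1] at h2
  have h2 := (hu2 x).unique h2
  have h1 := h1 x
  have hs := Real.tanh_sq_lt_one ((x - t * u x) / δ)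
  clear hT
  set T := Real.tanh ((x - t * u x) / δ)
  set d := deriv u x
  set d2 := deriv (deriv u) x
  have hg : 0 ≤ k * (1 - T ^ 2) := mul_nonneg hk (by linarith)
  have e1 : δ * d = k * (1 - T ^ 2) * (1 - t * d) := by
    have := h1
    field_simp at this
    linear_combination this
  have hd : 0 ≤ d := by
    have : d * (δ + t * (k * (1 - T ^ 2))) = k * (1 - T ^ 2) := by linear_combination e1
    have hpos : 0 < δ + t * (k * (1 - T ^ 2)) := by positivity
    by_contra! hneg
    nlinarith
  have e2 : (1 - t * d) * (δ + t * (k * (1 - T ^ 2))) = δ := by linear_combination (-t) * e1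
  have hv : 0 ≤ 1 - t * d := by
    have hpos : 0 < δ + t * (k * (1 - T ^ 2)) := by positivity
    by_contra! hneg
    nlinarith
  refine ⟨hd, by linarith, ?_, ?_⟩
  · have : k * (1 - T ^ 2) * (1 - t * d) ≤ k * 1 * 1 := by
      gcongr
      · nlinarith
      · nlinarith [mul_nonneg ht hd]
    linarith
  · have hpos : 0 < δ + t * (k * (1 - T ^ 2)) := by positivity
    have e3 : d2 * (δ + t * (k * (1 - T ^ 2))) = -(2 * T * d * (1 - t * d)) := by
      have h3 := h2
      field_simp at h3
      have h4 : δ * (d2 * (δ + t * (k * (1 - T ^ 2)))) = δ * -(2 * T * d * (1 - t * d)) := by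
        linear_combination h3 + 2 * T * (1 - t * d) * e1
      exact mul_left_cancel₀ hδ.ne' h4
    refine mul_right_cancel₀ hpos.ne' (e3.trans ?_)
    field_simp
    linear_combination T * d * (1 - t * d) * e2

/-- Derivative estimates for the smooth approximate
rarefaction wave of the Burgers equation with `tanh` initial data: for all
`t ≥ 0` and `p ∈ [1,∞]`,
`‖∂ₓ w(t,·)‖_{L^p(ℝ)} ≤ C (δ+t)^{−1+1/p}` and
`‖∂ₓ² w(t,·)‖_{L^p(ℝ)} ≤ C (δ+t)^{−1} δ^{−1+1/p}`, where `C` depends only on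
`w₋, w₊` (not on `δ`, `t` or `p`). -/
theorem burgers_smooth_rarefaction_derivative_decay
    (wm wp : ℝ) (hw : wm < wp) :
    ∃ C : ℝ, 0 < C ∧
      ∀ δ : ℝ, 0 < δ →
      ∀ w : ℝ → ℝ → ℝ,
        (∀ t, 0 ≤ t → ContDiff ℝ 2 (w t)) →
        (∀ t, 0 ≤ t → ∀ x,
          HasDerivAt (fun s => w s x) (-(w t x * deriv (w t) x)) t) →
        (∀ x, w 0 x = (wp + wm) / 2 + (wp - wm) / 2 * Real.tanh (x / δ)) →
        ∀ t, 0 ≤ t → ∀ p : ℝ≥0∞, 1 ≤ p →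
          eLpNorm (deriv (w t)) p volume ≤
              ENNReal.ofReal (C * (δ + t) ^ (-1 + p⁻¹.toReal)) ∧
          eLpNorm (deriv (deriv (w t))) p volume ≤
              ENNReal.ofReal (C * (δ + t)⁻¹ * δ ^ (-1 + p⁻¹.toReal)) := by
  set m := (wp + wm) / 2
  obtain ⟨k, hk, hkw⟩ : ∃ k, 0 < k ∧ (wp - wm) / 2 = k := ⟨_, by linarith, rfl⟩
  rw [hkw]
  refine ⟨2 * (k + 1), by positivity, fun δ hδ w hC2 hderiv hinit t ht p hp => ?_⟩
  have hB : IsBurgersOn w (Ici 0) :=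
    ⟨fun t ht => (hC2 t ht).of_le (by norm_num), fun t ht x => hderiv t ht x⟩
  have himp : ∀ x, w t x = m + k * Real.tanh ((x - t * w t x) / δ) := fun x => by
    rw [← hinit, hB.implicit ht x]
  have hu := hC2 t ht
  set u := w t
  have hd1 : ContDiff ℝ 1 (deriv u) :=
    (contDiff_succ_iff_deriv.1 (show ContDiff ℝ (1 + 1) u by exact_mod_cast hu)).2.2
  have hu1 : ∀ x, HasDerivAt u (deriv u x) x := fun x =>
    (hu.differentiable (by norm_num) x).hasDerivAt
  have hu2 : ∀ x, HasDerivAt (deriv u) (deriv (deriv u) x) x := fun x =>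
    (hd1.differentiable (by norm_num) x).hasDerivAt
  have hcont2 : Continuous (deriv (deriv u)) := hd1.continuous_deriv le_rfl
  have hD := deriv_of_implicit_tanh hu hk.le hδ ht himp
  have hδt : 0 < δ + t := by linarith
  have hsup : ∀ x, deriv u x ≤ (k + 1) / (δ + t) := fun x => by
    rw [le_div_iff₀ hδt]
    linarith [(hD x).2.1, (hD x).2.2.1]
  have hfac : ∀ x, 0 ≤ deriv u x * (1 - t * deriv u x) ^ 2 := fun x =>
    mul_nonneg (hD x).1 (sq_nonneg _)
  constructor
  · refine eLpNorm_le_of_bound_of_lintegral (by positivity) hδt (fun x => ?_) ?_ hp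
    · rw [abs_of_nonneg (hD x).1]
      refine (hsup x).trans ?_
      gcongr
      linarith
    · refine (lintegral_enorm_deriv_le_of_monotone (lo := m - k) (hi := m + k) hu1 hd1.continuous
        (fun x => (hD x).1) (fun x => ?_) fun x => ?_).trans
        (ENNReal.ofReal_le_ofReal (by linarith))
      · rw [himp]
        nlinarith [Real.neg_one_lt_tanh ((x - t * u x) / δ)]
      · rw [himp]
        nlinarith [Real.tanh_lt_one ((x - t * u x) / δ)]
  · refine eLpNorm_le_of_bound_of_lintegral (by positivity) hδ (fun x => ?_) ?_ hp
    · rw [(hD x).2.2.2, abs_mul, abs_neg, abs_mul, abs_of_nonneg (hfac x),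
        abs_of_pos (show 0 < 2 / δ by positivity)]
      have h1 : (1 - t * deriv u x) ^ 2 ≤ 1 := by
        nlinarith [mul_nonneg ht (hD x).1, (hD x).2.1]
      calc 2 / δ * |Real.tanh ((x - t * u x) / δ)| * (deriv u x * (1 - t * deriv u x) ^ 2)
          ≤ 2 / δ * 1 * ((k + 1) / (δ + t) * 1) := by
            have := (hD x).1
            gcongr
            · exact (Real.abs_tanh_lt_one _).le
            · exact hsup x
        _ = 2 * (k + 1) * (δ + t)⁻¹ / δ := by
            field_simp
    · have hymono : Monotone fun x => x - t * u x := by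
        refine monotone_of_deriv_nonneg
          (differentiable_id.sub ((hu.differentiable (by norm_num)).const_mul t)) fun x => ?_
        rw [((hasDerivAt_id' x).fun_sub ((hu1 x).const_mul t)).deriv]
        linarith [(hD x).2.1]
      have hzero : t * m - t * u (t * m) = 0 := by
        have h0 := himp (t * m)
        rcases le_total 0 (t * m - t * u (t * m)) with h | h
        · have := Real.tanh_nonneg_of_nonneg (div_nonneg h hδ.le)
          nlinarith [mul_nonneg ht (mul_nonneg hk.le this)]
        · have := Real.tanh_nonpos_of_nonpos (div_nonpos_of_nonpos_of_nonneg h hδ.le)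
          nlinarith [mul_nonneg ht (mul_nonneg hk.le (neg_nonneg.2 this))]
      refine (lintegral_enorm_deriv_le_of_unimodal (c := t * m) hu2 hcont2 (fun x hx => ?_)
        (fun x hx => ?_) (fun x => (hD x).1) hsup).trans (ENNReal.ofReal_le_ofReal ?_)
      · have h1 : x - t * u x ≤ 0 := (hymono hx).trans hzero.le
        have := Real.tanh_nonpos_of_nonpos (div_nonpos_of_nonpos_of_nonneg h1 hδ.le)
        rw [(hD x).2.2.2]
        refine mul_nonneg (neg_nonneg.2 (mul_nonpos_of_nonneg_of_nonpos ?_ this)) (hfac x)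
        positivity
      · have h1 : 0 ≤ x - t * u x := hzero.ge.trans (hymono hx)
        have := Real.tanh_nonneg_of_nonneg (div_nonneg h1 hδ.le)
        rw [(hD x).2.2.2]
        refine mul_nonpos_of_nonpos_of_nonneg (neg_nonpos.2 (mul_nonneg ?_ this)) (hfac x)
        positivity
      · rw [div_eq_mul_inv, mul_assoc]
end

section
/- There exist δ₀ ∈ (0,1) and a constant C > 0, depending only on w₋ and w₊, such that for every δ ∈ (0, δ₀] and every t > 0: sup_{x ∈ ℝ} |w(t,x) − w^r(x/t)| ≤ C δ t^{−1} (log(1+t) + |log δ|). -/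
/-- The centered rarefaction wave of the Burgers equation. -/
noncomputable def burgersRarefaction (wm wp : ℝ) (ξ : ℝ) : ℝ :=
  if ξ ≤ wm then wm else if ξ ≤ wp then ξ else wp

open Set Filter Topology

/-- Downward real induction on a compact interval. -/
theorem Icc_induction_down {s t : ℝ} {P : ℝ → Prop} (ht : P t)
    (hlim : ∀ m ∈ Ico s t, (∀ σ ∈ Ioc m t, P σ) → P m)
    (hstep : ∀ m ∈ Ioc s t, P m → ∃ m' < m, ∀ σ ∈ Ioo m' m, s ≤ σ → P σ) :
    ∀ σ ∈ Icc s t, P σ := by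
  intro σ₀ hσ₀
  have hst : s ≤ t := hσ₀.1.trans hσ₀.2
  set A : Set ℝ := {σ | σ ∈ Icc s t ∧ ∀ σ' ∈ Icc σ t, P σ'} with hA
  have htA : t ∈ A := ⟨⟨hst, le_rfl⟩, fun σ' h => by rwa [le_antisymm h.2 h.1]⟩
  have hbdd : BddBelow A := ⟨s, fun σ h => h.1.1⟩
  set m := sInf A with hm
  have hmt : m ≤ t := csInf_le hbdd htA
  have hsm : s ≤ m := le_csInf ⟨t, htA⟩ fun σ h => h.1.1
  have hIoc : ∀ σ ∈ Ioc m t, P σ := by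
    intro σ hσ
    obtain ⟨τ, hτ, hτσ⟩ := exists_lt_of_csInf_lt ⟨t, htA⟩ hσ.1
    exact hτ.2 σ ⟨hτσ.le, hσ.2⟩
  have hPm : P m := by
    rcases hmt.eq_or_lt with h | h
    · rwa [h]
    · exact hlim m ⟨hsm, h⟩ hIoc
  have hIcc : ∀ σ ∈ Icc m t, P σ := by
    intro σ hσ
    rcases hσ.1.eq_or_lt with h | h
    · rwa [← h]
    · exact hIoc σ ⟨h, hσ.2⟩
  rcases hsm.eq_or_lt with h | h
  · exact hIcc σ₀ ⟨h ▸ hσ₀.1, hσ₀.2⟩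
  · exfalso
    obtain ⟨m', hm', hP⟩ := hstep m ⟨h, hmt⟩ hPm
    obtain ⟨τ, hτ1, hτ2⟩ := exists_between (max_lt hm' h)
    have hτA : τ ∈ A := by
      refine ⟨⟨(le_max_right _ _).trans hτ1.le, hτ2.le.trans hmt⟩, fun σ hσ => ?_⟩
      rcases lt_or_ge σ m with h' | h'
      · exact hP σ ⟨(le_max_left _ _).trans_lt (hτ1.trans_le hσ.1), h'⟩
          ((le_max_right _ _).trans (hτ1.le.trans hσ.1))
      · exact hIcc σ ⟨h', hσ.2⟩
    exact absurd (csInf_le hbdd hτA) (not_le.mpr hτ2)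

/-- Near `(t₀, x₀)`, `W` is constant along its characteristic lines followed backward in time. -/
def IsCharRegular (W : ℝ → ℝ → ℝ) (t₀ x₀ : ℝ) : Prop :=
  ∃ ε > 0, ∀ s t x, 0 ≤ s → s ≤ t → |s - t₀| < ε → |t - t₀| < ε → |x - x₀| < ε →
    |x - (t - s) * W t x - x₀| < ε → W s (x - (t - s) * W t x) = W t x

theorem isCharRegular_of_neg (W : ℝ → ℝ → ℝ) {t₀ : ℝ} (ht : t₀ < 0) (x₀ : ℝ) :
    IsCharRegular W t₀ x₀ := by
  refine ⟨-t₀, by linarith, fun s t x hs _ h _ _ _ => ?_⟩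
  rw [abs_lt] at h
  linarith

theorem isOpen_isCharRegular (W : ℝ → ℝ → ℝ) :
    IsOpen {p : ℝ × ℝ | IsCharRegular W p.1 p.2} := by
  rw [Metric.isOpen_iff]
  rintro ⟨t₀, x₀⟩ ⟨ε, hε, H⟩
  refine ⟨ε / 2, by positivity, ?_⟩
  rintro ⟨t₁, x₁⟩ h
  rw [Metric.mem_ball, Prod.dist_eq, max_lt_iff, Real.dist_eq, Real.dist_eq] at h
  have key : ∀ a b c : ℝ, |a - b| < ε / 2 → |b - c| < ε / 2 → |a - c| < ε := fun a b c h1 h2 => by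
    rw [abs_lt] at *
    constructor <;> linarith
  exact ⟨ε / 2, by positivity, fun s t x hs hst h1 h2 h3 h4 =>
    H s t x hs hst (key _ _ _ h1 h.1) (key _ _ _ h2 h.1) (key _ _ _ h3 h.2) (key _ _ _ h4 h.2)⟩

theorem eq_of_segment_isCharRegular {W : ℝ → ℝ → ℝ} {s t x : ℝ} (hs : 0 ≤ s) (hst : s ≤ t)
    (h : ∀ σ ∈ Icc s t, IsCharRegular W σ (x - (t - σ) * W t x)) :
    W s (x - (t - s) * W t x) = W t x := by
  set u := W t x with hu
  have hcont : ∀ m, Tendsto (fun σ => x - (t - σ) * u) (𝓝 m) (𝓝 (x - (t - m) * u)) := fun m =>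
    (by fun_prop : Continuous fun σ => x - (t - σ) * u).tendsto m
  have aux : ∀ m, ∀ ε > 0, ∃ η > 0, ∀ σ, |σ - m| < η →
      |σ - m| < ε ∧ |x - (t - σ) * u - (x - (t - m) * u)| < ε := by
    intro m ε hε
    obtain ⟨η, hη, H⟩ := Metric.tendsto_nhds_nhds.1 (hcont m) ε hε
    refine ⟨min η ε, lt_min hη hε, fun σ hσ => ⟨hσ.trans_le (min_le_right _ _), ?_⟩⟩
    exact H (by rw [Real.dist_eq]; exact hσ.trans_le (min_le_left _ _))
  have step : ∀ m ∈ Icc s t, ∃ η > 0, ∀ σ σ', s ≤ σ' → σ' ≤ σ → |σ - m| < η → |σ' - m| < η →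
      W σ (x - (t - σ) * u) = u → W σ' (x - (t - σ') * u) = u := by
    intro m hm
    obtain ⟨ε, hε, H⟩ := h m hm
    obtain ⟨η, hη, hη'⟩ := aux m ε hε
    refine ⟨η, hη, fun σ σ' h1 h2 h3 h4 h5 => ?_⟩
    have e : x - (t - σ) * u - (σ - σ') * W σ (x - (t - σ) * u) = x - (t - σ') * u := by
      rw [h5]; ring
    have := H σ' σ (x - (t - σ) * u) (hs.trans h1) h2 (hη' _ h4).1 (hη' _ h3).1 (hη' _ h3).2
      (by rw [e]; exact (hη' _ h4).2)
    rw [e, h5] at this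
    exact this
  refine Icc_induction_down (s := s) (t := t) (P := fun σ => W σ (x - (t - σ) * u) = u)
    (by simp [hu]) ?_ ?_ s ⟨le_rfl, hst⟩
  · intro m hm hP
    obtain ⟨η, hη, H⟩ := step m ⟨hm.1, hm.2.le⟩
    obtain ⟨σ, h1, h2⟩ := exists_between (lt_min hm.2 (by linarith : m < m + η))
    refine H σ m hm.1 h1.le ?_ (by simpa using hη) (hP σ ⟨h1, h2.le.trans (min_le_left _ _)⟩)
    rw [abs_of_pos (by linarith)]
    linarith [h2.trans_le (min_le_right _ _)]
  · intro m hm hP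
    obtain ⟨η, hη, H⟩ := step m ⟨hm.1.le, hm.2⟩
    refine ⟨m - η, by linarith, fun σ hσ hsσ => H m σ hsσ hσ.2.le (by simpa using hη) ?_ hP⟩
    rw [abs_lt]
    constructor <;> linarith [hσ.1, hσ.2]

theorem abs_segment_le {x u s t σ x₀ r : ℝ} (hσ : σ ∈ Icc s t) (h1 : |x - x₀| ≤ r)
    (h2 : |x - (t - s) * u - x₀| ≤ r) : |x - (t - σ) * u - x₀| ≤ r := by
  rw [abs_le] at *
  rcases le_total 0 u with hu | hu
  · have := mul_nonneg (sub_nonneg.2 hσ.1) hu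
    have := mul_nonneg (sub_nonneg.2 hσ.2) hu
    constructor <;> linarith
  · have := mul_nonpos_of_nonneg_of_nonpos (sub_nonneg.2 hσ.1) hu
    have := mul_nonpos_of_nonneg_of_nonpos (sub_nonneg.2 hσ.2) hu
    constructor <;> linarith

theorem char_le_initial {W : ℝ → ℝ → ℝ} (hc : ∀ x, Continuous fun t => W t x)
    (hx : ∀ t, Continuous (W t)) {a t x x₀ r : ℝ} (hat : a < t)
    (H : ∀ s T z, a < s → s ≤ T → T ≤ t → |z - x₀| ≤ r → |z - (T - s) * W T z - x₀| ≤ r →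
      W s (z - (T - s) * W T z) = W T z)
    (hxr : |x - x₀| ≤ r) (hp : |x - (t - a) * W t x - x₀| < r) :
    W t x ≤ W a (x - (t - a) * W t x) := by
  set u := W t x with hu
  set p := x - (t - a) * u with hpdef
  by_contra! hlt
  obtain ⟨c, hc1, hc2⟩ := exists_between hlt
  have hL : ∀ T, a < T → T ≤ t → W T (p + (T - a) * u) = u ∧ |p + (T - a) * u - x₀| ≤ r := by
    intro T h1 h2
    have e : x - (t - T) * u = p + (T - a) * u := by rw [hpdef]; ring
    have h3 : |x - (t - T) * u - x₀| ≤ r := abs_segment_le ⟨h1.le, h2⟩ hxr hp.le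
    have h4 := H T t x h1 h2 le_rfl hxr h3
    rw [← hu, e] at h4
    rw [e] at h3
    exact ⟨h4, h3⟩
  have hp' := abs_lt.1 hp
  set z₁ := x₀ + r with hz₁
  have hpz : p < z₁ := by rw [hz₁]; linarith
  obtain ⟨T, hT1, hT2, haT, hTt⟩ : ∃ T, (T - a) * |W T z₁| < (z₁ - p) / 2 ∧
      p + (T - a) * u < z₁ ∧ a < T ∧ T < t := by
    have e1 : Tendsto (fun T => (T - a) * |W T z₁|) (𝓝[>] a) (𝓝 ((a - a) * |W a z₁|)) :=
      ((by have := hc z₁; fun_prop : Continuous fun T => (T - a) * |W T z₁|).tendsto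
        a).mono_left nhdsWithin_le_nhds
    have e2 : Tendsto (fun T => p + (T - a) * u) (𝓝[>] a) (𝓝 (p + (a - a) * u)) :=
      ((by fun_prop : Continuous fun T => p + (T - a) * u).tendsto a).mono_left nhdsWithin_le_nhds
    exact ((e1.eventually_lt_const (by simpa using hpz)).and
      ((e2.eventually_lt_const (by simpa using hpz)).and (Ioo_mem_nhdsGT hat))).exists
  have hTc : 0 < (T - a) * (u - c) := mul_pos (by linarith) (by linarith)
  obtain ⟨y, hy1, hy2, hpy, hy3⟩ : ∃ y, W a y < c ∧ y < p + (T - a) * (u - c) / 2 ∧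
      p < y ∧ y < (p + z₁) / 2 := by
    have e1 := ((hx a).tendsto p).mono_left (nhdsWithin_le_nhds (s := Ioi p))
    exact ((e1.eventually_lt_const hc1).and ((eventually_lt_nhds (by linarith)
      |>.filter_mono nhdsWithin_le_nhds).and (Ioo_mem_nhdsGT (by linarith)))).exists
  obtain ⟨s, hs1, hs2, hs3, has, hsT⟩ : ∃ s, W s y < c ∧
      (s - a) * |c| < (T - a) * (u - c) / 2 ∧ p + (s - a) * u < y ∧ a < s ∧ s < T := by
    have e1 := ((hc y).tendsto a).mono_left (nhdsWithin_le_nhds (s := Ioi a))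
    have e2 : Tendsto (fun s => (s - a) * |c|) (𝓝[>] a) (𝓝 ((a - a) * |c|)) :=
      ((by fun_prop : Continuous fun s => (s - a) * |c|).tendsto a).mono_left nhdsWithin_le_nhds
    have e3 : Tendsto (fun T => p + (T - a) * u) (𝓝[>] a) (𝓝 (p + (a - a) * u)) :=
      ((by fun_prop : Continuous fun T => p + (T - a) * u).tendsto a).mono_left nhdsWithin_le_nhds
    exact ((e1.eventually_lt_const hy1).and ((e2.eventually_lt_const (by simpa using hTc)).and
      ((e3.eventually_lt_const (by simpa using hpy)).and (Ioo_mem_nhdsGT haT)))).exists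
  obtain ⟨hLT, hLTr⟩ := hL T haT hTt.le
  have hmid : y ∈ Icc (p + (T - a) * u - (T - s) * W T (p + (T - a) * u))
      (z₁ - (T - s) * W T z₁) := by
    rw [hLT]
    constructor
    · linarith
    · have h1 : (T - s) * W T z₁ ≤ (T - s) * |W T z₁| :=
        mul_le_mul_of_nonneg_left (le_abs_self _) (by linarith)
      have h2 : (T - s) * |W T z₁| ≤ (T - a) * |W T z₁| :=
        mul_le_mul_of_nonneg_right (by linarith) (abs_nonneg _)
      linarith
  obtain ⟨z, hz, hzy⟩ := intermediate_value_Icc (f := fun z => z - (T - s) * W T z) hT2.le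
    (by have := hx T; fun_prop) hmid
  simp only at hzy
  rw [abs_le] at hLTr
  have hWs := H s T z has hsT.le hTt.le
    (by rw [abs_le]; constructor <;> linarith [hz.1, hz.2])
    (by rw [hzy, abs_le]; constructor <;> linarith)
  rw [hzy] at hWs
  rw [hWs] at hs1
  have h5 : (T - s) * W T z ≤ (T - s) * c := mul_le_mul_of_nonneg_left hs1.le (by linarith)
  have h6 : -((s - a) * c) ≤ (s - a) * |c| := by
    rw [← mul_neg]
    exact mul_le_mul_of_nonneg_left (neg_le_abs c) (by linarith)
  linarith [hz.1]

theorem char_eq_initial {W : ℝ → ℝ → ℝ} (hc : ∀ x, Continuous fun t => W t x)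
    (hx : ∀ t, Continuous (W t)) {a t x x₀ r : ℝ} (hat : a < t)
    (H : ∀ s T z, a < s → s ≤ T → T ≤ t → |z - x₀| ≤ r → |z - (T - s) * W T z - x₀| ≤ r →
      W s (z - (T - s) * W T z) = W T z)
    (hxr : |x - x₀| ≤ r) (hp : |x - (t - a) * W t x - x₀| < r) :
    W a (x - (t - a) * W t x) = W t x := by
  refine le_antisymm ?_ (char_le_initial hc hx hat H hxr hp)
  have flip : ∀ p q : ℝ, |-p - -q| = |p - q| := fun p q => by rw [← abs_neg]; congr 1; ring
  have e : ∀ z T s : ℝ, -(z - (T - s) * -W T (-z)) = -z - (T - s) * W T (-z) := by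
    intros; ring
  have := char_le_initial (W := fun t x => -W t (-x)) (x := -x) (x₀ := -x₀) (r := r)
    (fun x => (hc _).neg) (fun t => ((hx t).comp continuous_neg).neg) hat
    (fun s T z h1 h2 h3 h4 h5 => by
      simp only [e]
      rw [H s T (-z) h1 h2 h3 (by rw [← flip]; simpa using h4)
        (by rw [← flip, ← e]; simpa using h5)])
    (by rwa [flip]) (by rw [← flip, e]; simpa using hp)
  simp only [e] at this
  simpa using this
/-- Quantitative `C^{1,1}` control of `f` on the ball of radius `r` around `x₀`, expressed
through values of `f` only, so that it is preserved by pointwise limits. -/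
def IsControlled (n : ℝ) (f : ℝ → ℝ) (x₀ r : ℝ) : Prop :=
  ∀ y z q, |y - x₀| < r → |z - x₀| < r → |q - x₀| < r →
    |f y| ≤ n ∧ |f z - f y| ≤ n * |z - y| ∧
      |(f z - f y) * (q - y) - (f q - f y) * (z - y)| ≤
        n * |z - y| * |q - y| * (|z - y| + |q - y|)

theorem ContDiff.exists_isControlled {f : ℝ → ℝ} (hf : ContDiff ℝ 2 f) (x₀ : ℝ) :
    ∃ n : ℕ, IsControlled n f x₀ (1 / (n + 1)) := by
  have hf1 : ContDiff ℝ 1 (deriv f) := by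
    have : ContDiff ℝ (1 + 1) f := by simpa [one_add_one_eq_two] using hf
    exact (contDiff_succ_iff_deriv.1 this).2.2
  have hf2 : Continuous (deriv (deriv f)) := hf1.continuous_deriv le_rfl
  have bound : ∀ g : ℝ → ℝ, Continuous g → ∃ M, ∀ y ∈ Metric.closedBall x₀ 1, |g y| ≤ M :=
    fun g hg => (isCompact_closedBall x₀ 1).exists_bound_of_continuousOn hg.continuousOn
  obtain ⟨M₀, hM₀⟩ := bound f hf.continuous
  obtain ⟨M₁, hM₁⟩ := bound (deriv f) hf1.continuous
  obtain ⟨M₂, hM₂⟩ := bound (deriv (deriv f)) hf2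
  have hconv := convex_closedBall x₀ (1 : ℝ)
  have hfd : Differentiable ℝ f := hf.differentiable (by norm_num)
  have hfd1 : Differentiable ℝ (deriv f) := hf1.differentiable (by norm_num)
  have lip : ∀ y ∈ Metric.closedBall x₀ 1, ∀ z ∈ Metric.closedBall x₀ 1,
      |f z - f y| ≤ M₁ * |z - y| := fun y hy z hz =>
    hconv.norm_image_sub_le_of_norm_deriv_le (fun x _ => hfd x) (fun x hx => hM₁ x hx) hy hz
  have lip1 : ∀ y ∈ Metric.closedBall x₀ 1, ∀ z ∈ Metric.closedBall x₀ 1,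
      |deriv f z - deriv f y| ≤ M₂ * |z - y| := fun y hy z hz =>
    hconv.norm_image_sub_le_of_norm_deriv_le (fun x _ => hfd1 x) (fun x hx => hM₂ x hx) hy hz
  have hM₂0 : 0 ≤ M₂ := (abs_nonneg _).trans (hM₂ x₀ (by simp))
  have taylor : ∀ y ∈ Metric.closedBall x₀ 1, ∀ z ∈ Metric.closedBall x₀ 1,
      |f z - f y - deriv f y * (z - y)| ≤ M₂ * |z - y| * |z - y| := by
    intro y hy z hz
    have hd : ∀ x, HasDerivAt (fun x => f x - deriv f y * x) (deriv f x - deriv f y) x :=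
      fun x => by
        have h := (hfd x).hasDerivAt.fun_sub ((hasDerivAt_id' x).const_mul (deriv f y))
        rwa [mul_one] at h
    have hsub : uIcc y z ⊆ Metric.closedBall x₀ 1 := by
      rw [← segment_eq_uIcc]
      exact hconv.segment_subset hy hz
    have := (convex_uIcc y z).norm_image_sub_le_of_norm_hasDerivWithin_le
      (f := fun x => f x - deriv f y * x) (C := M₂ * |z - y|)
      (fun x _ => (hd x).hasDerivWithinAt)
      (fun x hx => (lip1 y hy x (hsub hx)).trans
        (mul_le_mul_of_nonneg_left (abs_sub_left_of_mem_uIcc hx) hM₂0))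
      left_mem_uIcc right_mem_uIcc
    rw [Real.norm_eq_abs, Real.norm_eq_abs] at this
    convert this using 2
    ring
  obtain ⟨n, hn⟩ := exists_nat_ge (max M₀ (max M₁ M₂))
  simp only [max_le_iff] at hn
  refine ⟨n, fun y z q hy hz hq => ?_⟩
  have mem : ∀ y, |y - x₀| < 1 / ((n : ℝ) + 1) → y ∈ Metric.closedBall x₀ 1 := fun y hy => by
    rw [Metric.mem_closedBall, Real.dist_eq]
    exact hy.le.trans ((div_le_one (by positivity)).2 (by simp))
  have hy := mem y hy
  have hz := mem z hz
  have hq := mem q hq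
  refine ⟨(hM₀ y hy).trans hn.1, (lip y hy z hz).trans
    (mul_le_mul_of_nonneg_right hn.2.1 (abs_nonneg _)), ?_⟩
  have e : (f z - f y) * (q - y) - (f q - f y) * (z - y) =
      (f z - f y - deriv f y * (z - y)) * (q - y) -
        (f q - f y - deriv f y * (q - y)) * (z - y) := by ring
  rw [e]
  calc _ ≤ |f z - f y - deriv f y * (z - y)| * |q - y| +
        |f q - f y - deriv f y * (q - y)| * |z - y| := by
        rw [← abs_mul, ← abs_mul]; exact abs_sub _ _
    _ ≤ M₂ * |z - y| * |z - y| * |q - y| + M₂ * |q - y| * |q - y| * |z - y| :=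
        add_le_add (mul_le_mul_of_nonneg_right (taylor y hy z hz) (abs_nonneg _))
          (mul_le_mul_of_nonneg_right (taylor y hy q hq) (abs_nonneg _))
    _ = M₂ * (|z - y| * |q - y| * (|z - y| + |q - y|)) := by ring
    _ ≤ n * (|z - y| * |q - y| * (|z - y| + |q - y|)) :=
        mul_le_mul_of_nonneg_right hn.2.2 (by positivity)
    _ = _ := by ring

theorem isClosed_isControlled {W : ℝ → ℝ → ℝ} (hc : ∀ x, Continuous fun t => W t x) (n r : ℝ) :
    IsClosed {p : ℝ × ℝ | IsControlled n (W p.1) p.2 r} := by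
  have hW : ∀ y, Continuous fun p : ℝ × ℝ => W p.1 y := fun y => (hc y).comp continuous_fst
  have ho : ∀ y, IsOpen {p : ℝ × ℝ | |y - p.2| < r} := fun y =>
    isOpen_lt (by fun_prop) continuous_const
  simp only [IsControlled, ofPred_forall]
  refine isClosed_iInter fun y => isClosed_iInter fun z => isClosed_iInter fun q => ?_
  have hy := hW y
  have hz := hW z
  have hq := hW q
  have h₁ : IsClosed {p : ℝ × ℝ | |W p.1 y| ≤ n} := isClosed_le (by fun_prop) continuous_const
  have h₂ : IsClosed {p : ℝ × ℝ | |W p.1 z - W p.1 y| ≤ n * |z - y|} :=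
    isClosed_le (by fun_prop) continuous_const
  have h₃ : IsClosed {p : ℝ × ℝ | |(W p.1 z - W p.1 y) * (q - y) - (W p.1 q - W p.1 y) * (z - y)| ≤
      n * |z - y| * |q - y| * (|z - y| + |q - y|)} :=
    isClosed_le (by fun_prop) continuous_const
  exact isClosed_imp (ho y) (isClosed_imp (ho z) (isClosed_imp (ho q)
    (h₁.and (h₂.and h₃))))

/-- `W` solves the Burgers equation for nonnegative times, in the sense of separate
differentiability, and is extended to negative times so as to stay separately continuous. -/
structure IsBurgersSolution (W : ℝ → ℝ → ℝ) : Prop where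
  continuous_time : ∀ x, Continuous fun t => W t x
  contDiff : ∀ t, ContDiff ℝ 2 (W t)
  hasDerivWithinAt : ∀ t, 0 ≤ t → ∀ x,
    HasDerivWithinAt (fun s => W s x) (-(W t x * deriv (W t) x)) (Ici 0) t

theorem IsBurgersSolution.eventually_line_le {W : ℝ → ℝ → ℝ} (hW : IsBurgersSolution W)
    {F : Set ℝ} {n x₀ r m y u ε : ℝ} (hF : ∀ s ∈ F, IsControlled n (W s) x₀ r) (hm : m ∈ F)
    (hm0 : 0 ≤ m) (hy : |y - x₀| < r) (hε : 0 < ε) :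
    ∃ m' < m, ∀ s ∈ Ioo m' m, 0 ≤ s → s ∈ F →
      |W s (y - (m - s) * u) - u| ≤ |W m y - u| * (1 + n * (m - s)) + ε * (m - s) := by
  set D := deriv (W m) y with hD
  have hn : 0 ≤ n := (abs_nonneg _).trans (hF m hm y y y hy hy hy).1
  have hball : ∀ᶠ z in 𝓝 y, |z - x₀| < r :=
    (by fun_prop : Continuous fun z => |z - x₀|).continuousAt.eventually_lt_const hy
  have hDn : |D| ≤ n := norm_deriv_le_of_lip' (f := W m) hn (by
    filter_upwards [hball] with z hz using (hF m hm y z z hy hz hz).2.1)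
  have hderiv : HasDerivAt (W m) D y :=
    (((hW.contDiff m).differentiable (by norm_num)) y).hasDerivAt
  set κ := ε / (8 * (1 + |u|)) with hκ
  have hκ0 : 0 < κ := by positivity
  have hκu : 2 * κ * |u| ≤ ε / 4 := by
    have : 2 * κ * (1 + |u|) = ε / 4 := by rw [hκ]; field_simp; norm_num
    nlinarith
  obtain ⟨q, ⟨hq1, hq2⟩, hyq, hq3⟩ : ∃ q, (|q - x₀| < r ∧
      |W m q - W m y - (q - y) * D| ≤ κ * |q - y|) ∧ y < q ∧ q < y + ε / (8 * (1 + n * |u|)) := by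
    have h1 := (hasDerivAt_iff_isLittleO.1 hderiv).def hκ0
    simp only [smul_eq_mul, Real.norm_eq_abs] at h1
    exact (((hball.and h1).filter_mono nhdsWithin_le_nhds).and
      (Ioo_mem_nhdsGT (lt_add_of_pos_right _ (by positivity)))).exists
  set d := q - y with hd
  have hd0 : 0 < d := sub_pos.2 hyq
  rw [abs_of_pos hd0] at hq2
  have hnd : 2 * n * |u| * d ≤ ε / 4 := by
    have h1 : d < ε / (8 * (1 + n * |u|)) := by linarith
    rw [lt_div_iff₀ (by positivity)] at h1
    nlinarith
  have e1 := (hasDerivWithinAt_iff_isLittleO.1 (hW.hasDerivWithinAt m hm0 y)).def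
    (by positivity : 0 < ε / 4)
  have e2 : ∀ᶠ s in 𝓝 m, |(W s q - W s y) - (W m q - W m y)| < κ * d := by
    have := hW.continuous_time q
    have := hW.continuous_time y
    have hc : Continuous fun s => |(W s q - W s y) - (W m q - W m y)| := by fun_prop
    exact (hc.tendsto m).eventually_lt_const (by simpa using by positivity)
  have e3 : ∀ᶠ s in 𝓝 m, |m - s| * |u| < d :=
    ((by fun_prop : Continuous fun s => |m - s| * |u|).tendsto m).eventually_lt_const
      (by simpa using hd0)
  have e4 : ∀ᶠ s in 𝓝 m, |y - (m - s) * u - x₀| < r :=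
    ((by fun_prop : Continuous fun s => |y - (m - s) * u - x₀|).tendsto m).eventually_lt_const
      (by simpa using hy)
  rw [eventually_nhdsWithin_iff] at e1
  obtain ⟨η, hη, H⟩ := Metric.eventually_nhds_iff.1 (e1.and (e2.and (e3.and e4)))
  refine ⟨m - η, by linarith, fun s hs hs0 hsF => ?_⟩
  obtain ⟨h1, h2, h3, h4⟩ := H (y := s) (by
    rw [Real.dist_eq, abs_lt]; constructor <;> linarith [hs.1, hs.2])
  have h1 := h1 hs0
  simp only [smul_eq_mul, Real.norm_eq_abs] at h1
  have hh : 0 < m - s := by linarith [hs.2]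
  rw [abs_sub_comm s m] at h1
  set h := m - s with hhdef
  rw [abs_of_pos hh] at h1 h3
  have h5 := (hF s hsF y (y - h * u) q hy h4 hq1).2.2
  have e : y - h * u - y = -(h * u) := by ring
  rw [e, ← hd, abs_neg, abs_mul, abs_of_pos hh, abs_of_pos hd0] at h5
  set A := W s (y - h * u) - W s y with hA
  set Q := W s q - W s y with hQ
  have h6 : n * (h * |u|) * d * (h * |u| + d) ≤ (ε / 4) * h * d := by
    calc n * (h * |u|) * d * (h * |u| + d) ≤ n * (h * |u|) * d * (2 * d) :=
          mul_le_mul_of_nonneg_left (by linarith) (by positivity)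
      _ = (2 * n * |u| * d) * (h * d) := by ring
      _ ≤ (ε / 4) * (h * d) := mul_le_mul_of_nonneg_right hnd (by positivity)
      _ = _ := by ring
  have h7 : |Q - d * D| ≤ 2 * κ * d := by
    rw [abs_le] at *
    rw [abs_lt] at h2
    constructor <;> linarith [h2.1, h2.2, hq2.1, hq2.2]
  have h8 : |(Q - d * D) * (h * u)| ≤ (ε / 4) * h * d := by
    rw [abs_mul, abs_mul, abs_of_pos hh]
    calc |Q - d * D| * (h * |u|) ≤ 2 * κ * d * (h * |u|) :=
          mul_le_mul_of_nonneg_right h7 (by positivity)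
      _ = (2 * κ * |u|) * (h * d) := by ring
      _ ≤ (ε / 4) * (h * d) := mul_le_mul_of_nonneg_right hκu (by positivity)
      _ = _ := by ring
  have h9 : |(A + h * u * D) * d| ≤ (ε / 2 * h) * d := by
    have e : (A + h * u * D) * d = (A * d - Q * -(h * u)) - (Q - d * D) * (h * u) := by ring
    rw [e]
    refine (abs_sub _ _).trans ?_
    linarith
  rw [abs_mul, abs_of_pos hd0] at h9
  have h10 := le_of_mul_le_mul_right h9 hd0
  have e : W s (y - h * u) - u = (A + h * u * D) +
      (W s y - W m y - (s - m) * -(W m y * D)) + ((W m y - u) + h * D * (W m y - u)) := by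
    rw [hA, hhdef]; ring
  have h11 : |h * D * (W m y - u)| ≤ h * n * |W m y - u| := by
    rw [abs_mul, abs_mul, abs_of_pos hh]
    gcongr
  rw [e]
  calc _ ≤ |A + h * u * D| + |W s y - W m y - (s - m) * -(W m y * D)| +
        (|W m y - u| + |h * D * (W m y - u)|) :=
        (abs_add_le _ _).trans (add_le_add (abs_add_le _ _) (abs_add_le _ _))
    _ ≤ _ := by nlinarith

theorem isClosed_singularTimes (W : ℝ → ℝ → ℝ) (x₀ r : ℝ) :
    IsClosed {t | ∃ x, |x - x₀| ≤ r ∧ ¬ IsCharRegular W t x} := by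
  rw [← isOpen_compl_iff, isOpen_iff_mem_nhds]
  intro t ht
  have hsub : ({t} : Set ℝ) ×ˢ Metric.closedBall x₀ r ⊆
      {p : ℝ × ℝ | IsCharRegular W p.1 p.2} := by
    rintro ⟨t', x⟩ ⟨h1, h2⟩
    obtain rfl : t' = t := h1
    by_contra h
    exact ht ⟨x, h2, h⟩
  obtain ⟨U, V, hU, -, htU, hV, hUV⟩ := generalized_tube_lemma isCompact_singleton
    (isCompact_closedBall x₀ r) (isOpen_isCharRegular W) hsub
  filter_upwards [hU.mem_nhds (htU rfl)] with σ hσ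
  rintro ⟨x, hx, hns⟩
  exact hns (hUV (mk_mem_prod hσ (hV hx)) : IsCharRegular W σ x)

/-- If no time in `(s, t]` is singular then backward characteristics reach time `s`. -/
theorem IsBurgersSolution.char_of_regular_Ioc {W : ℝ → ℝ → ℝ} (hW : IsBurgersSolution W)
    {s t x x₀ r : ℝ} (hs : 0 ≤ s) (hst : s ≤ t)
    (hreg : ∀ σ ∈ Ioc s t, ∀ z, |z - x₀| ≤ r → IsCharRegular W σ z)
    (hx : |x - x₀| ≤ r) (hp : |x - (t - s) * W t x - x₀| < r) :
    W s (x - (t - s) * W t x) = W t x := by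
  rcases hst.eq_or_lt with rfl | hst
  · simp
  refine char_eq_initial hW.continuous_time (fun t => (hW.contDiff t).continuous) hst
    (fun σ T z h1 h2 h3 h4 h5 => eq_of_segment_isCharRegular (hs.trans h1.le) h2
      fun τ hτ => hreg τ ⟨h1.trans_le hτ.1, hτ.2.trans h3⟩ _ (abs_segment_le hτ h4 h5)) hx hp

/-- If no time in `(s, t)` is singular then backward characteristics reach time `s`. -/
theorem IsBurgersSolution.char_of_regular_Ioo {W : ℝ → ℝ → ℝ} (hW : IsBurgersSolution W)
    {s t x x₀ r : ℝ} (hs : 0 ≤ s) (hst : s < t)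
    (hreg : ∀ σ ∈ Ioo s t, ∀ z, |z - x₀| ≤ r → IsCharRegular W σ z)
    (hx : |x - x₀| ≤ r) (hp : |x - (t - s) * W t x - x₀| < r) :
    W s (x - (t - s) * W t x) = W t x := by
  have hWx := hW.continuous_time x
  have hpos : Tendsto (fun T => x - (T - s) * W T x) (𝓝[<] t) (𝓝 (x - (t - s) * W t x)) :=
    ((by fun_prop : Continuous fun T => x - (T - s) * W T x).tendsto t).mono_left
      nhdsWithin_le_nhds
  have h1 : Tendsto (fun T => W s (x - (T - s) * W T x)) (𝓝[<] t)
      (𝓝 (W s (x - (t - s) * W t x))) :=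
    ((hW.contDiff s).continuous.tendsto _).comp hpos
  have h2 : Tendsto (fun T => W T x) (𝓝[<] t) (𝓝 (W t x)) :=
    (hWx.tendsto t).mono_left nhdsWithin_le_nhds
  refine tendsto_nhds_unique h1 (h2.congr' ?_)
  have h3 : ∀ᶠ T in 𝓝[<] t, |x - (T - s) * W T x - x₀| < r :=
    ((hpos.sub_const x₀).abs).eventually_lt_const hp
  filter_upwards [h3, Ioo_mem_nhdsLT hst] with T hT hT'
  exact (hW.char_of_regular_Ioc hs hT'.1.le
    (fun σ hσ => hreg σ ⟨hσ.1, hσ.2.trans_lt hT'.2⟩) hx hT).symm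

/-- A characteristic line issued from a singular time is followed backward through all singular
times at which `W` is controlled. -/
theorem IsBurgersSolution.char_of_controlled {W : ℝ → ℝ → ℝ} (hW : IsBurgersSolution W)
    {s a x x₀ r n : ℝ} (hs : 0 ≤ s) (hn : 0 ≤ n) (hr : 0 < r)
    {F : Set ℝ} (hFc : IsClosed F)
    (hreg : ∀ σ, σ ∉ F → ∀ z, |z - x₀| ≤ r → IsCharRegular W σ z)
    (hF : ∀ σ ∈ F, σ ∈ Icc s a → IsControlled n (W σ) x₀ r)
    (haF : a ∈ F) (hsa : s ≤ a) (hnr : (a - s) * n < r / 2)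
    (hline : ∀ σ ∈ Icc s a, |x - (a - σ) * W a x - x₀| < r / 2) :
    W s (x - (a - s) * W a x) = W a x := by
  set u := W a x with hu
  have jump : ∀ b ∈ F, ∀ m, b ∈ Ioc s a → m ∈ Ico s b → (∀ σ ∈ Ioo m b, σ ∉ F) →
      |x - (a - b) * u - (b - m) * W b (x - (a - b) * u) - x₀| < r ∧
      W m (x - (a - b) * u - (b - m) * W b (x - (a - b) * u)) = W b (x - (a - b) * u) := by
    intro b hb m hbm hm hgap
    have hlb := hline b ⟨hbm.1.le, hbm.2⟩
    have hlb' : |x - (a - b) * u - x₀| < r := hlb.trans (by linarith)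
    have hv := (hF b hb ⟨hbm.1.le, hbm.2⟩ _ _ _ hlb' hlb' hlb').1
    set v := W b (x - (a - b) * u)
    have h1 : |(b - m) * v| ≤ (a - s) * n := by
      rw [abs_mul, abs_of_pos (sub_pos.2 hm.2)]
      exact mul_le_mul (by linarith [hm.1, hbm.2]) hv (abs_nonneg _) (by linarith)
    have h2 : |x - (a - b) * u - (b - m) * v - x₀| < r := by
      rw [abs_lt] at hlb ⊢
      rw [abs_le] at h1
      constructor <;> linarith [h1.1, h1.2]
    exact ⟨h2, hW.char_of_regular_Ioo (hs.trans hm.1) hm.2 (fun σ hσ => hreg σ (hgap σ hσ))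
      hlb'.le h2⟩
  have gronwall : ∀ ε > 0, ∀ σ ∈ Icc s a, σ ∈ F →
      |W σ (x - (a - σ) * u) - u| ≤ ε * Real.exp ((n + 1) * (a - σ)) := by
    intro ε hε
    have growth : ∀ {m b A : ℝ}, m ≤ b → b ≤ a → A ≤ ε * Real.exp ((n + 1) * (a - b)) →
        A * (1 + n * (b - m)) + ε * (b - m) ≤ ε * Real.exp ((n + 1) * (a - m)) := by
      intro m b A hmb hba hA
      have h1 : ε ≤ ε * Real.exp ((n + 1) * (a - b)) :=
        le_mul_of_one_le_right hε.le (Real.one_le_exp (mul_nonneg (by linarith) (by linarith)))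
      have h2 : (n + 1) * (b - m) + 1 ≤ Real.exp ((n + 1) * (b - m)) := Real.add_one_le_exp _
      have e : ε * Real.exp ((n + 1) * (a - m)) =
          ε * Real.exp ((n + 1) * (a - b)) * Real.exp ((n + 1) * (b - m)) := by
        rw [mul_assoc, ← Real.exp_add]; congr 2; ring
      rw [e]
      set E := ε * Real.exp ((n + 1) * (a - b))
      have hd : 0 ≤ b - m := by linarith
      calc A * (1 + n * (b - m)) + ε * (b - m) ≤ E * (1 + n * (b - m)) + E * (b - m) := by gcongr
        _ = E * ((n + 1) * (b - m) + 1) := by ring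
        _ ≤ _ := mul_le_mul_of_nonneg_left h2 (hε.le.trans h1)
    refine Icc_induction_down (fun _ => ?_) ?_ ?_
    · simp [← hu, hε.le]
    · intro m hm hP hmF
      have hmI : m ∈ Icc s a := ⟨hm.1, hm.2.le⟩
      have hlm := hline m hmI
      by_cases hgap : ∃ η > 0, ∀ σ ∈ Ioo m (m + η), σ ∉ F
      · obtain ⟨η, hη, hgap⟩ := hgap
        have hcpt : IsCompact (Icc (m + η / 2) a ∩ F) := isCompact_Icc.inter_right hFc
        have haη : m + η ≤ a := by
          by_contra! h
          exact hgap a ⟨hm.2, h⟩ haF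
        obtain ⟨b, ⟨hbI, hbF⟩, hbmin⟩ := hcpt.exists_isLeast ⟨a, ⟨by linarith, le_rfl⟩, haF⟩
        have hmb : m < b := by linarith [hbI.1]
        have hbI' : b ∈ Ioc s a := ⟨hm.1.trans_lt hmb, hbI.2⟩
        obtain ⟨h1, h2⟩ := jump b hbF m hbI' ⟨hm.1, hmb⟩ (fun σ hσ hσF => by
          rcases lt_or_ge σ (m + η) with h | h
          · exact hgap σ ⟨hσ.1, h⟩ hσF
          · exact absurd (hbmin ⟨⟨by linarith, hσ.2.le.trans hbI.2⟩, hσF⟩) (not_le.2 hσ.2))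
        have hPb := hP b ⟨hmb, hbI.2⟩ hbF
        set v := W b (x - (a - b) * u)
        have hlm' : |x - (a - m) * u - x₀| < r := hlm.trans (by linarith)
        have h3 := (hF m hmF hmI _ _ _ h1 hlm' hlm').2.1
        rw [h2] at h3
        have e : x - (a - m) * u - (x - (a - b) * u - (b - m) * v) = (b - m) * (v - u) := by ring
        rw [e, abs_mul, abs_of_pos (sub_pos.2 hmb)] at h3
        refine le_trans ?_ (growth hmb.le hbI.2 hPb)
        have h4 := abs_sub_le (W m (x - (a - m) * u)) v u
        have : 0 ≤ ε * (b - m) := mul_nonneg hε.le (by linarith)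
        linarith
      · push Not at hgap
        refine le_of_forall_pos_le_add fun κ hκ => ?_
        have hWm := hW.continuous_time (x - (a - m) * u)
        have e1 : ∀ᶠ b in 𝓝 m, n * |(b - m) * u| +
            |W b (x - (a - m) * u) - W m (x - (a - m) * u)| < κ :=
          ((by fun_prop : Continuous fun b => n * |(b - m) * u| +
            |W b (x - (a - m) * u) - W m (x - (a - m) * u)|).tendsto m).eventually_lt_const
              (by simpa using hκ)
        obtain ⟨η, hη, H⟩ := Metric.eventually_nhds_iff.1 e1
        obtain ⟨b, hb, hbF⟩ := hgap (min η (a - m)) (lt_min hη (sub_pos.2 hm.2))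
        have hbη := hb.2.trans_le (add_le_add_right (min_le_left _ _) m)
        have hba := hb.2.trans_le (add_le_add_right (min_le_right _ _) m)
        have hbI : b ∈ Icc s a := ⟨hm.1.trans hb.1.le, by linarith⟩
        have h1 := H (y := b) (by rw [Real.dist_eq, abs_of_pos (sub_pos.2 hb.1)]; linarith)
        have hlm' : |x - (a - m) * u - x₀| < r := hlm.trans (by linarith)
        have hlb' : |x - (a - b) * u - x₀| < r := (hline b hbI).trans (by linarith)
        have h2 := (hF b hbF hbI _ _ _ hlb' hlm' hlm').2.1
        have e : x - (a - m) * u - (x - (a - b) * u) = -((b - m) * u) := by ring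
        rw [e, abs_neg] at h2
        have hPb := hP b ⟨hb.1, hbI.2⟩ hbF
        have hmono : ε * Real.exp ((n + 1) * (a - b)) ≤ ε * Real.exp ((n + 1) * (a - m)) := by
          have : m ≤ b := hb.1.le
          gcongr
        rw [abs_sub_comm (W b _) (W m _)] at h1
        have h3 := abs_sub_le (W m (x - (a - m) * u)) (W b (x - (a - m) * u)) u
        have h4 := abs_sub_le (W b (x - (a - m) * u)) (W b (x - (a - b) * u)) u
        linarith
    · intro m hm hP
      by_cases hmF : m ∈ F
      · have hmI : m ∈ Icc s a := ⟨hm.1.le, hm.2⟩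
        obtain ⟨m', hm', H⟩ := hW.eventually_line_le (F := F ∩ Icc s a) (u := u)
          (fun σ hσ => hF σ hσ.1 hσ.2) ⟨hmF, hmI⟩ (hs.trans hm.1.le)
          ((hline m hmI).trans (by linarith)) hε
        refine ⟨m', hm', fun σ hσ hsσ hσF => ?_⟩
        have h1 := H σ hσ (hs.trans hsσ) ⟨hσF, hsσ, hσ.2.le.trans hm.2⟩
        have e : x - (a - m) * u - (m - σ) * u = x - (a - σ) * u := by ring
        rw [e] at h1
        exact h1.trans (growth hσ.2.le hm.2 (hP hmF))
      · obtain ⟨m', hm', H⟩ := exists_Ioc_subset_of_mem_nhds (hFc.isOpen_compl.mem_nhds hmF)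
          ⟨m - 1, by linarith⟩
        exact ⟨m', hm', fun σ hσ _ hσF => absurd hσF (H ⟨hσ.1, hσ.2.le⟩)⟩
  have hline_eq : ∀ σ ∈ Icc s a, σ ∈ F → W σ (x - (a - σ) * u) = u := by
    intro σ hσ hσF
    rw [← sub_eq_zero, ← abs_eq_zero]
    refine le_antisymm (le_of_forall_pos_le_add fun κ hκ => ?_) (abs_nonneg _)
    have := gronwall (κ / Real.exp ((n + 1) * (a - σ))) (by positivity) σ hσ hσF
    rwa [div_mul_cancel₀ _ (Real.exp_pos _).ne', ← zero_add κ] at this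
  obtain ⟨b, ⟨hbI, hbF⟩, hbmin⟩ :=
    (isCompact_Icc.inter_right hFc : IsCompact (Icc s a ∩ F)).exists_isLeast
      ⟨a, ⟨hsa, le_rfl⟩, haF⟩
  have hb := hline_eq b hbI hbF
  rcases hbI.1.eq_or_lt with rfl | hsb
  · exact hb
  · have h := (jump b hbF s ⟨hsb, hbI.2⟩ ⟨le_rfl, hsb⟩ fun σ hσ hσF =>
      absurd (hbmin ⟨⟨hσ.1.le, hσ.2.le.trans hbI.2⟩, hσF⟩) (not_le.2 hσ.2)).2
    rw [hb] at h
    convert h using 2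
    ring

theorem IsBurgersSolution.isCharRegular_of_isControlled {W : ℝ → ℝ → ℝ}
    (hW : IsBurgersSolution W) {t₀ x₀ r n : ℝ} (hr : 0 < r) (hn : 0 ≤ n)
    (hB : ∀ t x, |t - t₀| < r → |x - x₀| ≤ r → ¬ IsCharRegular W t x →
      IsControlled n (W t) x₀ r) : IsCharRegular W t₀ x₀ := by
  set F : Set ℝ := {t | ∃ x, |x - x₀| ≤ r ∧ ¬ IsCharRegular W t x} with hFdef
  have hFc : IsClosed F := isClosed_singularTimes W x₀ r
  have hreg : ∀ σ, σ ∉ F → ∀ z, |z - x₀| ≤ r → IsCharRegular W σ z := fun σ hσ z hz => by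
    by_contra h
    exact hσ ⟨z, hz, h⟩
  have hε : r / (4 * (n + 1)) ≤ r / 4 :=
    div_le_div_of_nonneg_left hr.le (by norm_num) (by linarith)
  have hεn : 2 * (r / (4 * (n + 1))) * n < r / 2 := by
    rw [mul_div_assoc', div_mul_eq_mul_div, div_lt_div_iff₀ (by positivity) (by norm_num)]
    nlinarith
  refine ⟨r / (4 * (n + 1)), by positivity, fun s t x hs hst h1 h2 h3 h4 => ?_⟩
  set ε := r / (4 * (n + 1))
  set u := W t x with hu
  have hline : ∀ σ ∈ Icc s t, |x - (t - σ) * u - x₀| < r / 2 := fun σ hσ =>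
    (abs_segment_le hσ h3.le h4.le).trans_lt (by linarith)
  rw [abs_lt] at h1 h2
  by_cases hemp : (Icc s t ∩ F).Nonempty
  · obtain ⟨a, ⟨haI, haF⟩, hamax⟩ :=
      (isCompact_Icc.inter_right hFc : IsCompact (Icc s t ∩ F)).exists_isGreatest hemp
    have hgap := hW.char_of_regular_Ioc (x := x) (hs.trans haI.1) haI.2
      (fun σ hσ => hreg σ fun hσF => absurd
        (hamax ⟨⟨haI.1.trans hσ.1.le, hσ.2⟩, hσF⟩) (not_le.2 hσ.1))
      (by linarith : |x - x₀| ≤ r) ((hline a haI).trans (by linarith))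
    rw [← hu] at hgap
    have e : ∀ σ, x - (t - a) * u - (a - σ) * u = x - (t - σ) * u := fun σ => by ring
    have := hW.char_of_controlled (x := x - (t - a) * u) hs hn hr hFc hreg
      (fun σ ⟨z, hz, hz'⟩ hσ => hB σ z (by
        rw [abs_lt]; constructor <;> linarith [hσ.1, hσ.2, haI.2]) hz hz') haF haI.1
      (lt_of_le_of_lt (mul_le_mul_of_nonneg_right (by linarith [haI.2]) hn) hεn)
      (fun σ hσ => by rw [hgap, e]; exact hline σ ⟨hσ.1, hσ.2.trans haI.2⟩)
    rwa [hgap, e] at this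
  · exact hW.char_of_regular_Ioc hs hst
      (fun σ hσ => hreg σ fun hσF => hemp ⟨σ, ⟨hσ.1.le, hσ.2⟩, hσF⟩) (by linarith)
      ((hline s ⟨le_rfl, hst⟩).trans (by linarith))

theorem IsBurgersSolution.isCharRegular {W : ℝ → ℝ → ℝ} (hW : IsBurgersSolution W) (t x : ℝ) :
    IsCharRegular W t x := by
  by_contra hns
  set B : Set (ℝ × ℝ) := {p | IsCharRegular W p.1 p.2}ᶜ with hBdef
  have hBc : IsClosed B := (isOpen_isCharRegular W).isClosed_compl
  have : Nonempty B := ⟨⟨(t, x), hns⟩⟩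
  have : CompleteSpace B := hBc.completeSpace_coe
  obtain ⟨n, p, hp⟩ := nonempty_interior_of_iUnion_of_closed
    (f := fun n : ℕ => (Subtype.val : B → ℝ × ℝ) ⁻¹'
      {p | IsControlled n (W p.1) p.2 (1 / (n + 1))})
    (fun n => (isClosed_isControlled hW.continuous_time _ _).preimage continuous_subtype_val)
    (eq_univ_of_forall fun p => mem_iUnion.2 ((hW.contDiff p.1.1).exists_isControlled p.1.2))
  rw [mem_interior_iff_mem_nhds, Metric.mem_nhds_iff] at hp
  obtain ⟨ε, hε, hball⟩ := hp
  obtain ⟨⟨t₀, x₀⟩, hp⟩ := p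
  set r := min ε (1 / (n + 1)) / 3 with hr
  have hr0 : 0 < r := by positivity
  have hrε : 3 * r ≤ ε := by rw [hr]; linarith [min_le_left ε (1 / ((n : ℝ) + 1))]
  have hrn : 3 * r ≤ 1 / (n + 1) := by rw [hr]; linarith [min_le_right ε (1 / ((n : ℝ) + 1))]
  refine hp (hW.isCharRegular_of_isControlled hr0 (Nat.cast_nonneg n) fun t x ht hx hB => ?_)
  have hmem : (⟨(t, x), hB⟩ : B) ∈ Metric.ball (⟨(t₀, x₀), hp⟩ : B) ε := by
    rw [Metric.mem_ball, Subtype.dist_eq, Prod.dist_eq, max_lt_iff, Real.dist_eq, Real.dist_eq]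
    exact ⟨by linarith, by linarith⟩
  have hctrl : IsControlled n (W t) x (1 / (n + 1)) := hball hmem
  have key : ∀ y, |y - x₀| < r → |y - x| < 1 / ((n : ℝ) + 1) := fun y hy => by
    rw [abs_lt] at *
    rw [abs_le] at hx
    constructor <;> linarith
  exact fun y z q hy hz hq => hctrl y z q (key y hy) (key z hz) (key q hq)

theorem IsBurgersSolution.eq_initial {W : ℝ → ℝ → ℝ} (hW : IsBurgersSolution W) {t : ℝ}
    (ht : 0 ≤ t) (x : ℝ) : W 0 (x - t * W t x) = W t x := by
  simpa using eq_of_segment_isCharRegular le_rfl ht fun σ _ => hW.isCharRegular σ _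

theorem isBurgersSolution_extend {w : ℝ → ℝ → ℝ} (hC : ∀ t, 0 ≤ t → ContDiff ℝ 2 (w t))
    (hd : ∀ t, 0 ≤ t → ∀ x, HasDerivAt (fun s => w s x) (-(w t x * deriv (w t) x)) t) :
    IsBurgersSolution fun t => w (max t 0) where
  continuous_time x := by
    have h : ContinuousOn (fun s => w s x) (Ici 0) := fun t ht =>
      (hd t ht x).continuousAt.continuousWithinAt
    exact h.comp_continuous (continuous_id.max continuous_const) fun t => mem_Ici.2 (le_max_right _ _)
  contDiff t := hC _ (le_max_right _ _)
  hasDerivWithinAt t ht x := by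
    simp only [max_eq_left ht]
    refine (hd t ht x).hasDerivWithinAt.congr (fun s hs => ?_) ?_
    · rw [max_eq_left hs]
    · rw [max_eq_left ht]

theorem one_sub_tanh_le (y : ℝ) : 1 - Real.tanh y ≤ 2 * Real.exp (-(2 * y)) := by
  have h1 := Real.exp_pos y
  have h2 := Real.exp_pos (-y)
  have e : Real.exp (-(2 * y)) = Real.exp (-y) / Real.exp y := by
    rw [← Real.exp_sub]; congr 1; ring
  rw [Real.tanh_eq_sinh_div_cosh, Real.sinh_eq, Real.cosh_eq, e,
    div_div_div_cancel_right₀ (by norm_num), one_sub_div (by positivity), mul_div_assoc',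
    div_le_div_iff₀ (by positivity) h1]
  nlinarith [mul_pos h2 h2]

/-- A nonnegative `q` with `q ≤ A * t * exp (-(2 * (q / δ)))` is at most logarithmic in `t` and `δ`. -/
theorem le_of_le_mul_exp {A δ t q : ℝ} (hA : 0 ≤ A) (hδ : 0 < δ) (hδ' : δ ≤ 1 / 2) (ht : 0 < t)
    (hq : q ≤ A * t * Real.exp (-(2 * (q / δ)))) :
    q ≤ (1 / 2 + 2 * A) * δ * (Real.log (1 + t) + |Real.log δ|) := by
  have h1 : 0 ≤ Real.log (1 + t) := Real.log_nonneg (by linarith)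
  have hlog : Real.log δ ≤ -Real.log 2 := by
    rw [← Real.log_inv]; exact Real.log_le_log hδ (by linarith)
  have hlog2 : 1 / 2 < Real.log 2 := by linarith [Real.log_two_gt_d9]
  rw [abs_of_neg (by linarith)]
  set Λ := Real.log (1 + t) + -Real.log δ with hΛ
  have hΛ2 : 1 / 2 ≤ Λ := by linarith
  have hmain : 0 ≤ δ * Λ := by positivity
  rcases le_total q (δ / 2 * Λ) with h | h
  · nlinarith [mul_nonneg hA hmain]
  · have h2 : Λ ≤ 2 * (q / δ) := by
      rw [mul_div_assoc', le_div_iff₀ hδ]; linarith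
    have h3 : Real.exp (-(2 * (q / δ))) ≤ δ / (1 + t) := by
      rw [← Real.exp_log (by positivity : 0 < δ / (1 + t)), Real.log_div hδ.ne' (by linarith)]
      exact Real.exp_le_exp.2 (by linarith)
    have h4 : A * t * (δ / (1 + t)) ≤ A * δ := by
      rw [mul_div_assoc', div_le_iff₀ (by linarith)]
      nlinarith [mul_nonneg hA hδ.le]
    have h5 : q ≤ A * δ := hq.trans ((mul_le_mul_of_nonneg_left h3 (by positivity)).trans h4)
    nlinarith [mul_nonneg (mul_nonneg hA hδ.le) (by linarith : 0 ≤ 2 * Λ - 1)]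

theorem burgersRarefaction_spec {wm wp : ℝ} (hw : wm < wp) (ξ : ℝ) :
    (wm ≤ burgersRarefaction wm wp ξ ∧ burgersRarefaction wm wp ξ ≤ wp) ∧
      (wm < burgersRarefaction wm wp ξ → burgersRarefaction wm wp ξ ≤ ξ) ∧
      (burgersRarefaction wm wp ξ < wp → ξ ≤ burgersRarefaction wm wp ξ) := by
  unfold burgersRarefaction
  split_ifs with h1 h2
  · exact ⟨⟨le_rfl, hw.le⟩, fun h => absurd h (lt_irrefl _), fun _ => h1⟩
  · exact ⟨⟨(not_le.1 h1).le, h2⟩, fun _ => le_rfl, fun _ => le_rfl⟩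
  · exact ⟨⟨hw.le, le_rfl⟩, fun _ => (not_le.1 h2).le, fun h => absurd h (lt_irrefl _)⟩

theorem abs_sub_burgersRarefaction_le {wm wp δ t x v : ℝ} (hw : wm < wp) (hδ : 0 < δ)
    (hδ' : δ ≤ 1 / 2) (ht : 0 < t)
    (hv : v = (wp + wm) / 2 + (wp - wm) / 2 * Real.tanh ((x - t * v) / δ)) :
    |v - burgersRarefaction wm wp (x / t)| ≤
      (1 / 2 + 2 * (wp - wm)) * δ * t⁻¹ * (Real.log (1 + t) + |Real.log δ|) := by
  obtain ⟨⟨h1, h2⟩, h3, h4⟩ := burgersRarefaction_spec hw (x / t)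
  set R := burgersRarefaction wm wp (x / t)
  set p := x - t * v with hp
  have hA : 0 ≤ wp - wm := by linarith
  have hup : wp - v ≤ (wp - wm) * Real.exp (-(2 * (p / δ))) := by
    nlinarith [one_sub_tanh_le (p / δ)]
  have hlo : v - wm ≤ (wp - wm) * Real.exp (-(2 * (-p / δ))) := by
    have := one_sub_tanh_le (-p / δ)
    rw [neg_div, Real.tanh_neg, ← neg_div] at this
    nlinarith
  have hvm : wm < v := by nlinarith [Real.neg_one_lt_tanh (p / δ)]
  have hvp : v < wp := by nlinarith [Real.tanh_lt_one (p / δ)]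
  have main : ∀ d p' : ℝ, t * d ≤ p' → d ≤ (wp - wm) * Real.exp (-(2 * (p' / δ))) →
      d ≤ (1 / 2 + 2 * (wp - wm)) * δ * t⁻¹ * (Real.log (1 + t) + |Real.log δ|) := by
    intro d p' hd hd'
    have hq : t * d ≤ (wp - wm) * t * Real.exp (-(2 * (t * d / δ))) :=
      calc t * d ≤ t * ((wp - wm) * Real.exp (-(2 * (p' / δ)))) :=
            mul_le_mul_of_nonneg_left hd' ht.le
        _ = (wp - wm) * t * Real.exp (-(2 * (p' / δ))) := by ring
        _ ≤ _ := by gcongr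
    have := le_of_le_mul_exp hA hδ hδ' ht hq
    rw [← mul_le_mul_iff_right₀ ht]
    refine this.trans_eq ?_
    field_simp
  rcases le_total v R with h | h
  · rw [abs_sub_comm, abs_of_nonneg (by linarith)]
    refine main _ p ?_ (by linarith)
    have := (le_div_iff₀ ht).1 (h3 (hvm.trans_le h))
    rw [hp]; linarith
  · rw [abs_of_nonneg (by linarith)]
    refine main _ (-p) ?_ (by linarith)
    have := (div_le_iff₀ ht).1 (h4 (h.trans_lt hvp))
    rw [hp]; linarith

/-- The smooth approximate rarefaction wave of the Burgers
equation with `tanh(x/δ)` initial data converges to the centered rarefaction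
wave: there are `δ₀ ∈ (0,1)` and `C > 0` depending only on `w₋, w₊` such that
for all `δ ∈ (0,δ₀]` and `t > 0`,
`sup_x |w(t,x) − w^r(x/t)| ≤ C δ t⁻¹ (log(1+t) + |log δ|)`. -/
theorem burgers_smooth_rarefaction_convergence
    (wm wp : ℝ) (hw : wm < wp) :
    ∃ δ₀ ∈ Set.Ioo (0 : ℝ) 1, ∃ C : ℝ, 0 < C ∧
      ∀ δ ∈ Set.Ioc (0 : ℝ) δ₀,
      ∀ w : ℝ → ℝ → ℝ,
        (∀ t, 0 ≤ t → ContDiff ℝ 2 (w t)) →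
        (∀ t, 0 ≤ t → ∀ x,
          HasDerivAt (fun s => w s x) (-(w t x * deriv (w t) x)) t) →
        (∀ x, w 0 x = (wp + wm) / 2 + (wp - wm) / 2 * Real.tanh (x / δ)) →
        ∀ t : ℝ, 0 < t → ∀ x : ℝ,
          |w t x - burgersRarefaction wm wp (x / t)| ≤
            C * δ * t⁻¹ * (Real.log (1 + t) + |Real.log δ|) := by
  refine ⟨1 / 2, ⟨by norm_num, by norm_num⟩, 1 / 2 + 2 * (wp - wm), by linarith, ?_⟩
  intro δ hδ w hC hd h0 t ht x
  have h := (isBurgersSolution_extend hC hd).eq_initial ht.le x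
  simp only [max_self, max_eq_left ht.le, h0] at h
  exact abs_sub_burgersRarefaction_le hw hδ.1 hδ.2 ht h.symm
end

section
/- For every γ > 1 and all constants 0 < c₁ ≤ c₂ there exists a constant C > 0 such that for all ρ̃, θ̃, ρ, θ > 0 and all ψ ∈ ℝ³ satisfying c₁ ρ̃^{γ−1} ≤ θ̃ ≤ c₂ ρ̃^{γ−1}, ρ̃/2 ≤ ρ ≤ 3ρ̃/2 and θ̃/2 ≤ θ ≤ 3θ̃/2, one has R ρ θ̃ Φ(ρ̃/ρ) + ρ |ψ|²/2 + ρ θ̃ Φ(θ/θ̃) ≥ C ( ρ̃^{γ−2} (ρ − ρ̃)² + ρ̃ |ψ|² + ρ̃^{2−γ} (θ − θ̃)² ), where R := γ − 1. -/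
/-- The relative-entropy weight function `Φ(s) = s − ln s − 1`. -/
noncomputable def relEntPhi (s : ℝ) : ℝ := s - Real.log s - 1

/-- The quadratic lower bound of `Φ` on `(0, 2]`, obtained from `Φ(s) ≥ (√s - 1)²`. -/
theorem sq_sub_one_div_six_le_relEntPhi {s : ℝ} (hs : 0 < s) (hs' : s ≤ 2) :
    (s - 1) ^ 2 / 6 ≤ relEntPhi s := by
  unfold relEntPhi
  obtain ⟨t, ht, rfl⟩ : ∃ t : ℝ, 0 < t ∧ t ^ 2 = s :=
    ⟨√s, Real.sqrt_pos.2 hs, Real.sq_sqrt hs.le⟩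
  have hlog : Real.log (t ^ 2) ≤ 2 * (t - 1) := by
    rw [Real.log_pow]
    push_cast
    linarith [Real.log_le_sub_one_of_pos ht]
  have h6 : (t + 1) ^ 2 ≤ 6 := by nlinarith [sq_nonneg (t - 1)]
  have hmul : (t - 1) ^ 2 * (t + 1) ^ 2 ≤ (t - 1) ^ 2 * 6 :=
    mul_le_mul_of_nonneg_left h6 (sq_nonneg _)
  nlinarith

/-- Pointwise lower bound on the relative entropy (with
`R = γ − 1`): under the equivalence conditions `c₁ ρ̃^{γ−1} ≤ θ̃ ≤ c₂ ρ̃^{γ−1}`,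
`ρ̃/2 ≤ ρ ≤ 3ρ̃/2`, `θ̃/2 ≤ θ ≤ 3θ̃/2`, one has
`R ρ θ̃ Φ(ρ̃/ρ) + ρ|ψ|²/2 + ρ θ̃ Φ(θ/θ̃)
  ≥ C (ρ̃^{γ−2}(ρ−ρ̃)² + ρ̃|ψ|² + ρ̃^{2−γ}(θ−θ̃)²)`. -/
theorem relative_entropy_lower_bound
    (γ : ℝ) (hγ : 1 < γ) (c₁ c₂ : ℝ) (hc₁ : 0 < c₁) (hc : c₁ ≤ c₂) :
    ∃ C : ℝ, 0 < C ∧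
      ∀ (ρt θt ρ θ : ℝ) (ψ : EuclideanSpace ℝ (Fin 3)),
        0 < ρt → 0 < θt → 0 < ρ → 0 < θ →
        c₁ * ρt ^ (γ - 1) ≤ θt → θt ≤ c₂ * ρt ^ (γ - 1) →
        ρt / 2 ≤ ρ → ρ ≤ 3 * ρt / 2 →
        θt / 2 ≤ θ → θ ≤ 3 * θt / 2 →
        C * (ρt ^ (γ - 2) * (ρ - ρt) ^ 2 + ρt * ‖ψ‖ ^ 2 +
              ρt ^ (2 - γ) * (θ - θt) ^ 2) ≤
          (γ - 1) * ρ * θt * relEntPhi (ρt / ρ) + ρ * ‖ψ‖ ^ 2 / 2 +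
            ρ * θt * relEntPhi (θ / θt) := by
  refine ⟨min ((γ - 1) * c₁ / 9) (min (1 / 4) (1 / (12 * c₂))), ?_, ?_⟩
  · have hR : 0 < γ - 1 := by linarith
    have hc₂ : 0 < c₂ := by linarith
    positivity
  intro ρt θt ρ θ ψ hρt hθt hρ hθ hθt₁ hθt₂ hρ₁ hρ₂ hθ₁ hθ₂
  have hR : 0 < γ - 1 := by linarith
  have hc₂ : 0 < c₂ := by linarith
  set C := min ((γ - 1) * c₁ / 9) (min (1 / 4) (1 / (12 * c₂)))
  have hC₁ : C ≤ (γ - 1) * c₁ / 9 := min_le_left _ _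
  have hC₂ : C ≤ 1 / 4 := (min_le_right _ _).trans (min_le_left _ _)
  have hC₃ : C ≤ 1 / (12 * c₂) := (min_le_right _ _).trans (min_le_right _ _)
  have hpow : ρt ^ (γ - 1) = ρt ^ (γ - 2) * ρt := by
    rw [← Real.rpow_add_one hρt.ne']
    congr 1
    ring
  have hinv : ρt ^ (2 - γ) = (ρt ^ (γ - 2))⁻¹ := by
    rw [← Real.rpow_neg hρt.le]
    congr 1
    ring
  rw [hpow] at hθt₁ hθt₂
  rw [hinv]
  have ha : 0 < ρt ^ (γ - 2) := Real.rpow_pos_of_pos hρt _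
  set a := ρt ^ (γ - 2)
  have hΦρ := sq_sub_one_div_six_le_relEntPhi (div_pos hρt hρ)
    ((div_le_iff₀ hρ).2 (by linarith))
  have hΦθ := sq_sub_one_div_six_le_relEntPhi (div_pos hθ hθt)
    ((div_le_iff₀ hθt).2 (by linarith))
  have density : C * (a * (ρ - ρt) ^ 2) ≤ (γ - 1) * ρ * θt * relEntPhi (ρt / ρ) := by
    have hcoef : a * c₁ / 9 ≤ θt / (6 * ρ) := by
      rw [div_le_div_iff₀ (by norm_num) (by positivity)]
      nlinarith [mul_le_mul_of_nonneg_left hρ₂ (mul_pos ha hc₁).le]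
    calc C * (a * (ρ - ρt) ^ 2)
        ≤ (γ - 1) * c₁ / 9 * (a * (ρ - ρt) ^ 2) := by gcongr
      _ = (γ - 1) * (a * c₁ / 9) * (ρ - ρt) ^ 2 := by ring
      _ ≤ (γ - 1) * (θt / (6 * ρ)) * (ρ - ρt) ^ 2 := by gcongr
      _ = (γ - 1) * ρ * θt * ((ρt / ρ - 1) ^ 2 / 6) := by field_simp; ring
      _ ≤ (γ - 1) * ρ * θt * relEntPhi (ρt / ρ) := by gcongr
  have velocity : C * (ρt * ‖ψ‖ ^ 2) ≤ ρ * ‖ψ‖ ^ 2 / 2 := by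
    calc C * (ρt * ‖ψ‖ ^ 2) ≤ 1 / 4 * (ρt * ‖ψ‖ ^ 2) := by gcongr
      _ = ρt / 2 * ‖ψ‖ ^ 2 / 2 := by ring
      _ ≤ ρ * ‖ψ‖ ^ 2 / 2 := by gcongr
  have temperature : C * (a⁻¹ * (θ - θt) ^ 2) ≤ ρ * θt * relEntPhi (θ / θt) := by
    have hcoef : 1 / (12 * c₂ * a) ≤ ρ / (6 * θt) := by
      rw [div_le_div_iff₀ (by positivity) (by positivity)]
      nlinarith [mul_le_mul_of_nonneg_left hρ₁ (mul_pos ha hc₂).le]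
    calc C * (a⁻¹ * (θ - θt) ^ 2)
        ≤ 1 / (12 * c₂) * (a⁻¹ * (θ - θt) ^ 2) := by gcongr
      _ = 1 / (12 * c₂ * a) * (θ - θt) ^ 2 := by field_simp
      _ ≤ ρ / (6 * θt) * (θ - θt) ^ 2 := by gcongr
      _ = ρ * θt * ((θ / θt - 1) ^ 2 / 6) := by field_simp
      _ ≤ ρ * θt * relEntPhi (θ / θt) := by gcongr
  linarith
end
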